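/- arXiv:2512.22902 — 2 statements merged into one kernel-verified Lean document; each statement's English description precedes it below -/
import Mathlib

section
/- Let n be a positive perfect square and let Q be an integral binary quadratic form of discriminant 4n. Then, as T → ∞, F_T^Q = 6·T·log T/(π²·n^{1/2}) + o(T·log T). -/
open Filter Real Asymptotics

/-- The substitution action of `SL₂(ℤ)` on integral binary quadratic forms, where a form
`a x² + b x y + c y²` is encoded as the triple `(a, b, c)`: for `g = (p q; r s)` the form
`g • Q` is `(x, y) ↦ Q (p x + q y, r x + s y)`. -/
def actForm (g : Matrix.SpecialLinearGroup (Fin 2) ℤ) (Q : ℤ × ℤ × ℤ) : ℤ × ℤ × ℤ :=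
  let p := (g : Matrix (Fin 2) (Fin 2) ℤ) 0 0
  let q := (g : Matrix (Fin 2) (Fin 2) ℤ) 0 1
  let r := (g : Matrix (Fin 2) (Fin 2) ℤ) 1 0
  let s := (g : Matrix (Fin 2) (Fin 2) ℤ) 1 1
  (Q.1 * p ^ 2 + Q.2.1 * p * r + Q.2.2 * r ^ 2,
   2 * Q.1 * p * q + Q.2.1 * (p * s + q * r) + 2 * Q.2.2 * r * s,
   Q.1 * q ^ 2 + Q.2.1 * q * s + Q.2.2 * s ^ 2)

/-- Proper (`SL₂(ℤ)`) equivalence of integral binary quadratic forms. -/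
def ProperEquiv (Q Q' : ℤ × ℤ × ℤ) : Prop := ∃ g, actForm g Q = Q'

/-- `DTQ n Q T` is the number of `D(n)`-pairs `{a, c}` (written with `a > c`) with
`a, c ∈ {-T, …, T}` whose associated form `E_{ac} = [a, 2√(ac+n), c]` is properly
equivalent to `Q`. -/
noncomputable def DTQ (n : ℤ) (Q : ℤ × ℤ × ℤ) (T : ℝ) : ℕ :=
  Set.ncard {ac : ℤ × ℤ | ac.2 < ac.1 ∧ ac.1 ≠ 0 ∧ ac.2 ≠ 0 ∧
    |(ac.1 : ℝ)| ≤ T ∧ |(ac.2 : ℝ)| ≤ T ∧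
    ∃ b : ℤ, 0 ≤ b ∧ b ^ 2 = ac.1 * ac.2 + n ∧ ProperEquiv (ac.1, 2 * b, ac.2) Q}

/-- `FTQ Q T` is the number of integral binary quadratic forms `[a, b, c]` with
`|a| ≤ T`, `|c| ≤ T`, `a > c`, `b ≥ 0` which are properly equivalent to `Q`. -/
noncomputable def FTQ (Q : ℤ × ℤ × ℤ) (T : ℝ) : ℕ :=
  Set.ncard {f : ℤ × ℤ × ℤ | |(f.1 : ℝ)| ≤ T ∧ |(f.2.2 : ℝ)| ≤ T ∧
    f.2.2 < f.1 ∧ 0 ≤ f.2.1 ∧ ProperEquiv f Q}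

/-- `ω(d)`: the number of `SL₂(ℤ)`-automorphs of a primitive definite form of
discriminant `d`. -/
def omegaDisc (d : ℤ) : ℕ := if d = -4 then 4 else if d = -3 then 6 else 2

open ArithmeticFunction in
lemma sum_totient_div_sq_eq (N : ℕ) :
    ∑ r ∈ Finset.Ioc 0 N, (Nat.totient r : ℝ) / (r : ℝ) ^ 2 =
      ∑ e ∈ Finset.Ioc 0 N, (moebius e : ℝ) / (e : ℝ) ^ 2 * (harmonic (N / e) : ℝ) := by
  let F : ArithmeticFunction ℝ := ⟨fun e => (moebius e : ℝ) / (e : ℝ) ^ 2, by simp⟩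
  let G : ArithmeticFunction ℝ := ⟨fun l => ((l : ℝ))⁻¹, by simp⟩
  have h := ArithmeticFunction.sum_Ioc_mul_eq_sum_sum F G N
  have hG : ∀ M : ℕ, ∑ m ∈ Finset.Ioc 0 M, G m = (harmonic M : ℝ) := by
    intro M
    rw [harmonic_eq_sum_Icc]
    push_cast
    rfl
  simp only [hG] at h
  refine Eq.trans (Finset.sum_congr rfl fun r hr => ?_) h
  have hr0 : 0 < r := (Finset.mem_Ioc.mp hr).1
  have hinv := (sum_eq_iff_sum_mul_moebius_eq (f := fun i => (Nat.totient i : ℝ))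
    (g := fun i => (i : ℝ))).mp (fun n _ => by exact_mod_cast Nat.sum_totient n) r hr0
  rw [← hinv, Finset.sum_div, mul_apply]
  refine Finset.sum_congr rfl fun x hx => ?_
  have hx' := Nat.mem_divisorsAntidiagonal.mp hx
  have h1 : (x.1 : ℝ) ≠ 0 := by
    rintro h0; apply hx'.2; rw [← hx'.1]; simp [Nat.cast_eq_zero.mp h0]
  have h2 : (x.2 : ℝ) ≠ 0 := by
    rintro h0; apply hx'.2; rw [← hx'.1]; simp [Nat.cast_eq_zero.mp h0]
  change _ = (moebius x.1 : ℝ) / (x.1 : ℝ) ^ 2 * ((x.2 : ℝ))⁻¹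
  rw [← hx'.1]
  push_cast
  field_simp

open ArithmeticFunction in
lemma tsum_moebius_div_sq :
    ∑' e : ℕ, (moebius e : ℝ) / (e : ℝ) ^ 2 = 6 / π ^ 2 := by
  have h := LSeries_one_mul_Lseries_moebius (s := 2) (by norm_num)
  rw [LSeries_one_eq_riemannZeta (by norm_num), riemannZeta_two] at h
  have h2 : LSeries (fun n => ((moebius n : ℤ) : ℂ)) 2 =
      ((∑' e : ℕ, (moebius e : ℝ) / (e : ℝ) ^ 2 : ℝ) : ℂ) := by
    rw [LSeries, Complex.ofReal_tsum]
    refine tsum_congr fun n => ?_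
    rcases eq_or_ne n 0 with rfl | hn
    · simp
    · rw [LSeries.term_of_ne_zero hn]
      push_cast
      norm_cast
  rw [h2] at h
  have h3 : π ^ 2 / 6 * (∑' e : ℕ, (moebius e : ℝ) / (e : ℝ) ^ 2) = 1 := by exact_mod_cast h
  have := pi_pos
  field_simp at h3 ⊢
  linarith

lemma tendsto_harmonic_div_div_log (e : ℕ) (he : 0 < e) :
    Tendsto (fun N : ℕ => (harmonic (N / e) : ℝ) / log N) atTop (nhds 1) := by
  have hlog : Tendsto (fun N : ℕ => log (N : ℝ)) atTop atTop :=
    tendsto_log_atTop.comp tendsto_natCast_atTop_atTop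
  have hl : ∀ c : ℝ, Tendsto (fun N : ℕ => 1 + c / log (N : ℝ)) atTop (nhds 1) := by
    intro c
    simpa using (tendsto_const_nhds (x := (1 : ℝ))).add (hlog.const_div_atTop c)
  refine tendsto_of_tendsto_of_tendsto_of_le_of_le' (hl (-log e)) (hl (1 - log e)) ?_ ?_
  all_goals
    filter_upwards [hlog.eventually_gt_atTop 0, eventually_ge_atTop e] with N hN hNe
    have hN0 : (0 : ℝ) < N := by exact_mod_cast he.trans_le hNe
    have he0 : (0 : ℝ) < e := by exact_mod_cast he
    have hfl : N / e = ⌊(N : ℝ) / e⌋₊ := (Nat.floor_div_eq_div N e).symm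
    rw [one_add_div hN.ne', hfl]
    gcongr
  · have := log_le_harmonic_floor ((N : ℝ) / e) (by positivity)
    rw [log_div hN0.ne' he0.ne'] at this
    linarith
  · have := harmonic_floor_le_one_add_log ((N : ℝ) / e)
      (by rw [one_le_div he0]; exact_mod_cast hNe)
    rw [log_div hN0.ne' he0.ne'] at this
    linarith

open ArithmeticFunction (moebius abs_moebius_le_one) in
/-- The logarithmic average of `φ(r)/r`. -/
lemma tendsto_sum_totient_div_sq_div_log :
    Tendsto (fun N : ℕ => (∑ r ∈ Finset.Ioc 0 N, (Nat.totient r : ℝ) / (r : ℝ) ^ 2) / log N)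
      atTop (nhds (6 / π ^ 2)) := by
  have hlog : Tendsto (fun N : ℕ => log (N : ℝ)) atTop atTop :=
    tendsto_log_atTop.comp tendsto_natCast_atTop_atTop
  have key : Tendsto (fun N : ℕ => ∑' e : ℕ,
      (moebius e : ℝ) / (e : ℝ) ^ 2 * ((harmonic (N / e) : ℝ) / log N)) atTop
      (nhds (∑' e : ℕ, (moebius e : ℝ) / (e : ℝ) ^ 2)) := by
    refine tendsto_tsum_of_dominated_convergence (bound := fun e : ℕ => 2 * (1 / (e : ℝ) ^ 2))
      ((summable_one_div_nat_pow.mpr one_lt_two).mul_left 2) ?_ ?_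
    · intro e
      rcases Nat.eq_zero_or_pos e with rfl | he
      · simp
      · simpa using (tendsto_harmonic_div_div_log e he).const_mul
          ((moebius e : ℝ) / (e : ℝ) ^ 2)
    · filter_upwards [hlog.eventually_ge_atTop 1] with N hN e
      have hharm : (0 : ℝ) ≤ harmonic (N / e) ∧ (harmonic (N / e) : ℝ) ≤ 2 * log N := by
        refine ⟨?_, ?_⟩
        · rcases Nat.eq_zero_or_pos (N / e) with h | h
          · simp [h]
          · exact_mod_cast (harmonic_pos h.ne').le
        · rcases Nat.eq_zero_or_pos (N / e) with h | h
          · simp only [h, harmonic_zero]; push_cast; linarith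
          · have h1 := harmonic_le_one_add_log (N / e)
            have h2 : log ((N / e : ℕ) : ℝ) ≤ log N := by
              apply log_le_log (by exact_mod_cast h)
              exact_mod_cast Nat.div_le_self N e
            linarith
      have hmu : |(moebius e : ℝ)| ≤ 1 := by exact_mod_cast abs_moebius_le_one
      rw [norm_mul, norm_div, norm_div, Real.norm_eq_abs, Real.norm_eq_abs, Real.norm_eq_abs,
        Real.norm_eq_abs, abs_of_nonneg hharm.1, abs_of_nonneg (by linarith : 0 ≤ log (N : ℝ)),
        abs_of_nonneg (by positivity : (0 : ℝ) ≤ (e : ℝ) ^ 2), mul_comm]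
      gcongr
      rw [div_le_iff₀ (by linarith)]
      exact hharm.2
  rw [tsum_moebius_div_sq] at key
  refine key.congr fun N => ?_
  rw [sum_totient_div_sq_eq, Finset.sum_div, tsum_eq_sum (s := Finset.Ioc 0 N)]
  · exact Finset.sum_congr rfl fun e _ => by ring
  · intro e he
    rcases Nat.eq_zero_or_pos e with rfl | he0
    · simp
    · have : N < e := by simpa [he0] using he
      simp [Nat.div_eq_of_lt this]

/-- The product `(r x + s y) (α x + β y)` of two linear forms, as a coefficient triple. -/
def prodForm (r s α β : ℤ) : ℤ × ℤ × ℤ := (r * α, r * β + s * α, s * β)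

lemma actForm_one (Q : ℤ × ℤ × ℤ) : actForm 1 Q = Q := by
  simp [actForm]

lemma actForm_actForm (g h : Matrix.SpecialLinearGroup (Fin 2) ℤ) (Q : ℤ × ℤ × ℤ) :
    actForm h (actForm g Q) = actForm (g * h) Q := by
  simp only [actForm, Matrix.SpecialLinearGroup.coe_mul, Matrix.mul_apply, Fin.sum_univ_two,
    Prod.mk.injEq]
  refine ⟨?_, ?_, ?_⟩ <;> ring

lemma ProperEquiv.symm {Q Q' : ℤ × ℤ × ℤ} (h : ProperEquiv Q Q') : ProperEquiv Q' Q := by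
  obtain ⟨g, rfl⟩ := h
  exact ⟨g⁻¹, by rw [actForm_actForm, mul_inv_cancel, actForm_one]⟩

lemma ProperEquiv.trans {Q Q' Q'' : ℤ × ℤ × ℤ} (h : ProperEquiv Q Q') (h' : ProperEquiv Q' Q'') :
    ProperEquiv Q Q'' := by
  obtain ⟨g, rfl⟩ := h
  obtain ⟨g', rfl⟩ := h'
  exact ⟨g * g', by rw [actForm_actForm]⟩

lemma properEquiv_iff_exists {Q Q' : ℤ × ℤ × ℤ} :
    ProperEquiv Q Q' ↔ ∃ p q r s : ℤ, p * s - q * r = 1 ∧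
      Q' = (Q.1 * p ^ 2 + Q.2.1 * p * r + Q.2.2 * r ^ 2,
        2 * Q.1 * p * q + Q.2.1 * (p * s + q * r) + 2 * Q.2.2 * r * s,
        Q.1 * q ^ 2 + Q.2.1 * q * s + Q.2.2 * s ^ 2) := by
  constructor
  · rintro ⟨g, rfl⟩
    have hdet := g.det_coe
    rw [Matrix.det_fin_two] at hdet
    exact ⟨_, _, _, _, hdet, rfl⟩
  · rintro ⟨p, q, r, s, hdet, rfl⟩
    exact ⟨⟨!![p, q; r, s], by rw [Matrix.det_fin_two_of, hdet]⟩, by simp [actForm]⟩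

lemma ProperEquiv.disc_eq {Q Q' : ℤ × ℤ × ℤ} (h : ProperEquiv Q Q') :
    Q.2.1 ^ 2 - 4 * Q.1 * Q.2.2 = Q'.2.1 ^ 2 - 4 * Q'.1 * Q'.2.2 := by
  obtain ⟨p, q, r, s, hdet, rfl⟩ := properEquiv_iff_exists.mp h
  simp only
  linear_combination
    (-(Q.2.1 ^ 2 - 4 * Q.1 * Q.2.2) * (p * s - q * r + 1)) * hdet

/-- The involution `Q(x, y) ↦ -Q(y, -x)` on forms. -/
def negRot (Q : ℤ × ℤ × ℤ) : ℤ × ℤ × ℤ := (-Q.2.2, Q.2.1, -Q.1)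

lemma negRot_negRot (Q : ℤ × ℤ × ℤ) : negRot (negRot Q) = Q := by
  simp [negRot]

lemma ProperEquiv.negRot {Q Q' : ℤ × ℤ × ℤ} (h : ProperEquiv Q Q') :
    ProperEquiv (negRot Q) (negRot Q') := by
  obtain ⟨p, q, r, s, hdet, rfl⟩ := properEquiv_iff_exists.mp h
  refine properEquiv_iff_exists.mpr ⟨s, -r, -q, p, by linarith, ?_⟩
  simp only [_root_.negRot, Prod.mk.injEq]
  refine ⟨?_, ?_, ?_⟩ <;> ring

/-- A form of square discriminant `D²` is properly equivalent to some `D x y + k y²`. -/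
lemma exists_properEquiv_zero_left {Q : ℤ × ℤ × ℤ} {D : ℤ} (hD : D ≠ 0)
    (hQ : Q.2.1 ^ 2 - 4 * Q.1 * Q.2.2 = D ^ 2) : ∃ k : ℤ, ProperEquiv Q (0, D, k) := by
  obtain ⟨A, B, C⟩ := Q
  simp only at hQ
  obtain ⟨u, v, huv, h1, h2⟩ : ∃ u v : ℤ, (u ≠ 0 ∨ v ≠ 0) ∧ 2 * A * u + (B + D) * v = 0 ∧
      (B - D) * u + 2 * C * v = 0 := by
    by_cases h : A = 0 ∧ B + D = 0
    · refine ⟨2 * C, D - B, Or.inr ?_, ?_, by ring⟩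
      · have := h.2; omega
      · rw [h.1, h.2]; ring
    · refine ⟨B + D, -2 * A, ?_, by ring, by linear_combination hQ⟩
      by_contra hc
      push Not at hc
      exact h ⟨by omega, hc.1⟩
  have hpos : 0 < Int.gcd u v := Int.gcd_pos_iff.mpr huv
  obtain ⟨p, r, hcop, hp, hr⟩ := Int.exists_gcd_one hpos
  have hg : (Int.gcd u v : ℤ) ≠ 0 := by exact_mod_cast hpos.ne'
  obtain ⟨x, y, hxy⟩ := Int.isCoprime_iff_gcd_eq_one.mpr hcop
  have e1 : 2 * A * p + (B + D) * r = 0 := by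
    apply mul_right_cancel₀ hg
    linear_combination h1 - 2 * A * hp - (B + D) * hr
  have e2 : (B - D) * p + 2 * C * r = 0 := by
    apply mul_right_cancel₀ hg
    linear_combination h2 - (B - D) * hp - 2 * C * hr
  refine ⟨A * (-y) ^ 2 + B * (-y) * x + C * x ^ 2,
    properEquiv_iff_exists.mpr ⟨p, -y, r, x, by linarith, ?_⟩⟩
  simp only [Prod.mk.injEq]
  refine ⟨?_, ?_, trivial⟩
  · have : 2 * (A * p ^ 2 + B * p * r + C * r ^ 2) = 0 := by
      linear_combination p * e1 + r * e2
    omega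
  · linear_combination y * e1 - x * e2 - D * hxy

/-- The forms properly equivalent to `Q` of discriminant `D²`, in factored shape. -/
lemma exists_forall_properEquiv_iff {Q : ℤ × ℤ × ℤ} {D : ℤ} (hD : D ≠ 0)
    (hQ : Q.2.1 ^ 2 - 4 * Q.1 * Q.2.2 = D ^ 2) :
    ∃ k : ℤ, ∀ f : ℤ × ℤ × ℤ, ProperEquiv f Q ↔
      ∃ p q r s : ℤ, p * s - q * r = 1 ∧ f = prodForm r s (D * p + k * r) (D * q + k * s) := by
  obtain ⟨k, hk⟩ := exists_properEquiv_zero_left hD hQ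
  refine ⟨k, fun f => ?_⟩
  have : ProperEquiv f Q ↔ ProperEquiv (0, D, k) f :=
    ⟨fun h => hk.symm.trans h.symm, fun h => h.symm.trans hk.symm⟩
  rw [this, properEquiv_iff_exists]
  refine exists_congr fun p => exists_congr fun q => exists_congr fun r => exists_congr fun s =>
    and_congr_right fun _ => ?_
  rw [prodForm]
  ring_nf

/-- The forms `[a, b, c]` with `0 < c < a ≤ T` and `b > 0` properly equivalent to `Q`. -/
def posForms (Q : ℤ × ℤ × ℤ) (T : ℝ) : Set (ℤ × ℤ × ℤ) :=
  {f | 0 < f.2.2 ∧ f.2.2 < f.1 ∧ 0 < f.2.1 ∧ (f.1 : ℝ) ≤ T ∧ ProperEquiv f Q}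

/-- Numerator of the reduced fraction `r / s` for which `r x + s y` divides the form `f` of
discriminant `D²`; the sign of `D` selects one of the two linear factors. -/
def rootNum (D : ℤ) (f : ℤ × ℤ × ℤ) : ℤ := f.1 / Int.gcd f.1 ((f.2.1 + D) / 2)

/-- Denominator of the reduced fraction `r / s` for which `r x + s y` divides the form `f` of
discriminant `D²`. -/
def rootDen (D : ℤ) (f : ℤ × ℤ × ℤ) : ℤ := (f.2.1 + D) / 2 / Int.gcd f.1 ((f.2.1 + D) / 2)

lemma half_add_of_det {r s α β D : ℤ} (h : α * s - β * r = D) :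
    ((prodForm r s α β).2.1 + D) / 2 = s * α := by
  have : (prodForm r s α β).2.1 + D = 2 * (s * α) := by
    simp only [prodForm]; linear_combination -h
  rw [this]; simp

lemma half_sub_of_det {r s α β D : ℤ} (h : α * s - β * r = D) :
    ((prodForm r s α β).2.1 + -D) / 2 = r * β := by
  have : (prodForm r s α β).2.1 + -D = 2 * (r * β) := by
    simp only [prodForm]; linear_combination h
  rw [this]; simp

lemma gcd_mul_right_eq {r s α : ℤ} (hrs : IsCoprime r s) (hα : 0 < α) :
    (Int.gcd (r * α) (s * α) : ℤ) = α := by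
  rw [Int.gcd_mul_right, Int.isCoprime_iff_gcd_eq_one.mp hrs, one_mul, Int.natAbs_of_nonneg hα.le]

lemma rootNum_prodForm {r s α β D : ℤ} (h : α * s - β * r = D) (hrs : IsCoprime r s)
    (hα : 0 < α) : rootNum D (prodForm r s α β) = r := by
  rw [rootNum, half_add_of_det h, prodForm, gcd_mul_right_eq hrs hα]
  exact Int.mul_ediv_cancel _ hα.ne'

lemma rootDen_prodForm {r s α β D : ℤ} (h : α * s - β * r = D) (hrs : IsCoprime r s)
    (hα : 0 < α) : rootDen D (prodForm r s α β) = s := by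
  rw [rootDen, half_add_of_det h, prodForm, gcd_mul_right_eq hrs hα]
  exact Int.mul_ediv_cancel _ hα.ne'

lemma gcd_mul_rootNum_neg_prodForm {r s α β D : ℤ} (h : α * s - β * r = D) (hr : 0 < r)
    (hα : 0 < α) : (Int.gcd α β : ℤ) * rootNum (-D) (prodForm r s α β) = α := by
  have hg : 0 < (Int.gcd α β : ℤ) := by exact_mod_cast Int.gcd_pos_of_ne_zero_left _ hα.ne'
  rw [rootNum, half_sub_of_det h, prodForm, Int.gcd_mul_left, Nat.cast_mul,
    Int.natAbs_of_nonneg hr.le, Int.mul_ediv_mul_of_pos _ _ hr,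
    Int.mul_ediv_cancel' (Int.gcd_dvd_left _ _)]

/-- The factorization data of a form in `posForms Q T`. -/
structure IsPosRep (D k : ℤ) (f : ℤ × ℤ × ℤ) (p q r s : ℤ) : Prop where
  det : p * s - q * r = 1
  eq : f = prodForm r s (D * p + k * r) (D * q + k * s)
  r_pos : 0 < r
  s_pos : 0 < s
  fst_pos : 0 < D * p + k * r
  snd_pos : 0 < D * q + k * s

namespace IsPosRep

variable {D k : ℤ} {f : ℤ × ℤ × ℤ} {p q r s : ℤ}

lemma cross (h : IsPosRep D k f p q r s) :
    (D * p + k * r) * s - (D * q + k * s) * r = D := by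
  linear_combination D * h.det

lemma isCoprime (h : IsPosRep D k f p q r s) : IsCoprime r s :=
  ⟨-q, p, by linear_combination h.det⟩

lemma rootNum_eq (h : IsPosRep D k f p q r s) : rootNum D f = r := by
  rw [h.eq, rootNum_prodForm h.cross h.isCoprime h.fst_pos]

lemma rootDen_eq (h : IsPosRep D k f p q r s) : rootDen D f = s := by
  rw [h.eq, rootDen_prodForm h.cross h.isCoprime h.fst_pos]

lemma fst_eq (h : IsPosRep D k f p q r s) : f.1 = r * (D * p + k * r) := by
  rw [h.eq, prodForm]

lemma rootNum_neg_pos (h : IsPosRep D k f p q r s) : 0 < rootNum (-D) f := by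
  have := gcd_mul_rootNum_neg_prodForm h.cross h.r_pos h.fst_pos
  rw [← h.eq] at this
  exact pos_of_mul_pos_right (this ▸ h.fst_pos) (by positivity)

lemma rootNum_mul_rootNum_neg_le (h : IsPosRep D k f p q r s) :
    rootNum D f * rootNum (-D) f ≤ f.1 := by
  have h1 := gcd_mul_rootNum_neg_prodForm h.cross h.r_pos h.fst_pos
  rw [← h.eq] at h1
  have hg : 0 < (Int.gcd (D * p + k * r) (D * q + k * s) : ℤ) := by
    exact_mod_cast Int.gcd_pos_of_ne_zero_left _ h.fst_pos.ne'
  rw [h.rootNum_eq, h.fst_eq]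
  refine mul_le_mul_of_nonneg_left ?_ h.r_pos.le
  exact (le_mul_of_one_le_left h.rootNum_neg_pos.le (by omega)).trans_eq h1

lemma fst_le (hD : D ≠ 0) (h : IsPosRep D k f p q r s) :
    f.1 ≤ |D| * (rootNum D f * rootNum (-D) f) := by
  have h1 := gcd_mul_rootNum_neg_prodForm h.cross h.r_pos h.fst_pos
  rw [← h.eq] at h1
  have hg : (Int.gcd (D * p + k * r) (D * q + k * s) : ℤ) ≤ |D| := by
    refine Int.le_of_dvd (abs_pos.mpr hD) ((dvd_abs _ _).mpr ?_)
    have h2 := dvd_sub ((Int.gcd_dvd_left (D * p + k * r) (D * q + k * s)).mul_right s)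
      ((Int.gcd_dvd_right (D * p + k * r) (D * q + k * s)).mul_right r)
    rwa [h.cross] at h2
  rw [h.rootNum_eq, h.fst_eq]
  have := mul_pos h.r_pos h.rootNum_neg_pos
  calc _ = (Int.gcd (D * p + k * r) (D * q + k * s) : ℤ) * (r * rootNum (-D) f) := by
        rw [mul_left_comm, h1]
    _ ≤ _ := by gcongr

lemma den_lt (hf : f.2.2 < f.1) (h : IsPosRep D k f p q r s) : s < r + |D| := by
  have h1 := h.cross
  have h2 : s * (D * q + k * s) < r * (D * p + k * r) := by
    rw [h.eq] at hf; exact hf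
  have hr := h.r_pos
  have hs := h.s_pos
  have hβ := h.snd_pos
  generalize D * q + k * s = β at *
  generalize D * p + k * r = α at *
  by_contra! hc
  have h3 : β * ((s - r) * (s + r)) < r * D := by nlinarith
  have h4 : |D| * (s + r) ≤ β * ((s - r) * (s + r)) := by
    have : |D| ≤ β * (s - r) := by nlinarith [abs_nonneg D]
    nlinarith
  nlinarith [le_abs_self D, abs_nonneg D]

/-- Two forms with the same root have leading coefficients congruent modulo `D r²`. -/
lemma modEq (h : IsPosRep D k f p q r s) {f' : ℤ × ℤ × ℤ} {p' q' : ℤ}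
    (h' : IsPosRep D k f' p' q' r s) : f.1 ≡ f'.1 [ZMOD |D| * r ^ 2] := by
  have hdvd : r ∣ p' - p := by
    refine h.isCoprime.dvd_of_dvd_mul_right ⟨q' - q, ?_⟩
    linear_combination h'.det - h.det
  obtain ⟨j, hj⟩ := hdvd
  have h3 : D * r ^ 2 ∣ f'.1 - f.1 := ⟨j, by
    rw [h.fst_eq, h'.fst_eq]; linear_combination r * D * hj⟩
  refine (Int.modEq_iff_dvd).mpr ?_
  rw [← abs_sq r, ← abs_mul]
  exact (abs_dvd _ _).mpr h3

lemma eq_of_fst_eq (hD : D ≠ 0) (h : IsPosRep D k f p q r s) {f' : ℤ × ℤ × ℤ} {p' q' : ℤ}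
    (h' : IsPosRep D k f' p' q' r s) (hff : f.1 = f'.1) : f = f' := by
  rw [h.fst_eq, h'.fst_eq] at hff
  have hp : p = p' := by
    have := mul_left_cancel₀ h.r_pos.ne' hff
    exact mul_left_cancel₀ hD (add_right_cancel this)
  have hq : q = q' := by
    apply mul_right_cancel₀ h.r_pos.ne'
    linear_combination h'.det - h.det + s * hp
  rw [h.eq, h'.eq, hp, hq]

end IsPosRep

lemma exists_isPosRep {Q f : ℤ × ℤ × ℤ} {D k : ℤ} {T : ℝ}
    (hk : ∀ f : ℤ × ℤ × ℤ, ProperEquiv f Q ↔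
      ∃ p q r s : ℤ, p * s - q * r = 1 ∧ f = prodForm r s (D * p + k * r) (D * q + k * s))
    (hf : f ∈ posForms Q T) : ∃ p q r s, IsPosRep D k f p q r s := by
  obtain ⟨hc, hca, hb, -, hfQ⟩ := hf
  obtain ⟨p, q, r, s, hdet, hfe⟩ := (hk f).mp hfQ
  have key : ∀ p q r s : ℤ, p * s - q * r = 1 →
      f = prodForm r s (D * p + k * r) (D * q + k * s) → 0 < r →
      IsPosRep D k f p q r s := by
    intro p q r s hdet hfe hr
    have ha : 0 < r * (D * p + k * r) := by
      have : 0 < f.1 := hc.trans hca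
      rwa [hfe] at this
    rw [hfe] at hc hb
    simp only [prodForm] at hc hb
    have hα : 0 < D * p + k * r := pos_of_mul_pos_right ha hr.le
    have hs : 0 < s := by
      by_contra! hs
      have hβ : D * q + k * s < 0 := by
        by_contra! hβ
        nlinarith
      nlinarith
    exact ⟨hdet, hfe, hr, hs, hα, pos_of_mul_pos_right hc hs.le⟩
  rcases lt_trichotomy r 0 with hr | hr | hr
  · refine ⟨_, _, _, _, key (-p) (-q) (-r) (-s) (by linarith) ?_ (by omega)⟩
    rw [hfe]; simp only [prodForm, Prod.mk.injEq]
    refine ⟨?_, ?_, ?_⟩ <;> ring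
  · have : 0 < f.1 := hc.trans hca
    rw [hfe, hr] at this
    simp [prodForm] at this
  · exact ⟨_, _, _, _, key p q r s hdet hfe hr⟩

/-- Conversely, large elements of the progression attached to a root `r / s > 1` come from
forms in `posForms Q T`. -/
lemma exists_mem_posForms {Q : ℤ × ℤ × ℤ} {D k : ℤ} {T : ℝ} {p q r s a : ℤ}
    (hk : ∀ f : ℤ × ℤ × ℤ, ProperEquiv f Q ↔
      ∃ p q r s : ℤ, p * s - q * r = 1 ∧ f = prodForm r s (D * p + k * r) (D * q + k * s))
    (hdet : p * s - q * r = 1) (hs : 0 < s) (hsr : s < r) (ha : |D| * r < a) (haT : (a : ℝ) ≤ T)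
    (hmod : a ≡ r * (D * p + k * r) [ZMOD |D| * r ^ 2]) :
    ∃ f ∈ posForms Q T, rootNum D f = r ∧ rootDen D f = s ∧ f.1 = a := by
  have hdvd : D * r ^ 2 ∣ a - r * (D * p + k * r) := by
    have := (Int.modEq_iff_dvd).mp hmod.symm
    rw [← abs_sq r, ← abs_mul] at this
    exact (abs_dvd _ _).mp this
  obtain ⟨j, hj⟩ := hdvd
  have hr : 0 < r := hs.trans hsr
  set α := D * (p + j * r) + k * r with hα
  set β := D * (q + j * s) + k * s with hβ
  have hdet' : (p + j * r) * s - (q + j * s) * r = 1 := by linear_combination hdet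
  have hcross : α * s - β * r = D := by rw [hα, hβ]; linear_combination D * hdet
  have haα : a = r * α := by rw [hα]; linear_combination hj
  have hDα : |D| < α := by
    rw [haα, mul_comm] at ha
    exact lt_of_mul_lt_mul_left ha hr.le
  have hα0 : 0 < α := (abs_nonneg D).trans_lt hDα
  have hβ0 : 0 < β := by
    have : 0 < β * r := by nlinarith [le_abs_self D]
    exact pos_of_mul_pos_left this hr.le
  have hac : s * β < r * α := by
    have h1 : |D| * s < α * ((r - s) * (r + s)) := by
      have : r + s ≤ (r - s) * (r + s) := by nlinarith
      nlinarith
    have h2 : r * (s * β) < r * (r * α) := by nlinarith [neg_abs_le D]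
    exact lt_of_mul_lt_mul_left h2 hr.le
  have hcop : IsCoprime r s := ⟨-q, p, by linear_combination hdet⟩
  refine ⟨prodForm r s α β, ⟨?_, ?_, ?_, ?_, ?_⟩, rootNum_prodForm hcross hcop hα0,
    rootDen_prodForm hcross hcop hα0, haα.symm⟩
  · exact mul_pos hs hβ0
  · exact hac
  · exact add_pos (mul_pos hr hβ0) (mul_pos hs hα0)
  · simp only [prodForm]; rw [← haα]; exact haT
  · exact (hk _).mpr ⟨_, _, _, _, hdet', rfl⟩

lemma card_Ioc_filter_modEq_bounds (a b v : ℤ) {M : ℤ} (hM : 0 < M) :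
    ((b - a : ℝ) / M - 1 ≤ (((Finset.Ioc a b).filter (· ≡ v [ZMOD M])).card : ℝ)) ∧
    (a ≤ b → (((Finset.Ioc a b).filter (· ≡ v [ZMOD M])).card : ℝ) ≤ (b - a : ℝ) / M + 1) := by
  have h := Int.Ioc_filter_modEq_card a b hM v
  have hM' : (0 : ℚ) < M := by exact_mod_cast hM
  have e : ((b - v : ℚ) / M) - ((a - v : ℚ) / M) = (b - a : ℚ) / M := by ring
  have h1 := Int.floor_le ((b - v : ℚ) / M)
  have h2 := Int.lt_floor_add_one ((b - v : ℚ) / M)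
  have h3 := Int.floor_le ((a - v : ℚ) / M)
  have h4 := Int.lt_floor_add_one ((a - v : ℚ) / M)
  have hq : ((((Finset.Ioc a b).filter (· ≡ v [ZMOD M])).card : ℤ) : ℚ) =
      max ((⌊(b - v : ℚ) / M⌋ - ⌊(a - v : ℚ) / M⌋ : ℤ) : ℚ) 0 := by
    rw [h]; push_cast; rfl
  constructor
  · have : (b - a : ℚ) / M - 1 ≤ ((((Finset.Ioc a b).filter (· ≡ v [ZMOD M])).card : ℤ) : ℚ) := by
      rw [hq]
      refine le_trans ?_ (le_max_left _ _)
      push_cast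
      linarith
    exact_mod_cast this
  · intro hab
    have : ((((Finset.Ioc a b).filter (· ≡ v [ZMOD M])).card : ℤ) : ℚ) ≤ (b - a : ℚ) / M + 1 := by
      rw [hq]
      refine max_le ?_ ?_
      · push_cast
        linarith
      · have : (a : ℚ) ≤ b := by exact_mod_cast hab
        have : 0 ≤ (b - a : ℚ) / M := div_nonneg (by linarith) hM'.le
        linarith
    exact_mod_cast this

section Counting

variable {Q : ℤ × ℤ × ℤ} {D k : ℤ} {T : ℝ}

/-- A finite set of forms in `posForms Q T` sharing the same root has few elements. -/
lemma card_fiber_le (hD : D ≠ 0)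
    (hk : ∀ f : ℤ × ℤ × ℤ, ProperEquiv f Q ↔
      ∃ p q r s : ℤ, p * s - q * r = 1 ∧ f = prodForm r s (D * p + k * r) (D * q + k * s))
    {S : Finset (ℤ × ℤ × ℤ)} (hS : ∀ f ∈ S, f ∈ posForms Q T) {r s : ℤ}
    (hr : ∀ f ∈ S, rootNum D f = r) (hs : ∀ f ∈ S, rootDen D f = s) {Y : ℝ} (hY : 0 ≤ Y)
    (hSY : ∀ f ∈ S, (f.1 : ℝ) ≤ Y) :
    (S.card : ℝ) ≤ Y / ((|D| : ℤ) * (r : ℝ) ^ 2) + 1 := by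
  rcases S.eq_empty_or_nonempty with rfl | ⟨f₀, hf₀⟩
  · simp only [Finset.card_empty, Nat.cast_zero]; positivity
  have rep : ∀ f ∈ S, ∃ p q, IsPosRep D k f p q r s := by
    intro f hf
    obtain ⟨p, q, r', s', h⟩ := exists_isPosRep hk (hS f hf)
    obtain rfl : r' = r := h.rootNum_eq ▸ hr f hf
    obtain rfl : s' = s := h.rootDen_eq ▸ hs f hf
    exact ⟨p, q, h⟩
  obtain ⟨p₀, q₀, h₀⟩ := rep f₀ hf₀
  have hM : 0 < |D| * r ^ 2 := mul_pos (abs_pos.mpr hD) (pow_pos h₀.r_pos 2)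
  have hcard : S.card ≤ ((Finset.Ioc 0 ⌊Y⌋).filter (· ≡ f₀.1 [ZMOD |D| * r ^ 2])).card := by
    refine Finset.card_le_card_of_injOn (fun f => f.1) ?_ ?_
    · intro f hf
      obtain ⟨p, q, h⟩ := rep f hf
      simp only [Finset.coe_filter, Finset.mem_Ioc, Set.mem_ofPred_eq]
      exact ⟨⟨(hS f hf).1.trans (hS f hf).2.1, Int.le_floor.mpr (hSY f hf)⟩, h.modEq h₀⟩
    · intro f hf f' hf' hff
      obtain ⟨p, q, h⟩ := rep f hf
      obtain ⟨p', q', h'⟩ := rep f' hf'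
      exact h.eq_of_fst_eq hD h' hff
  have h2 := (card_Ioc_filter_modEq_bounds 0 ⌊Y⌋ f₀.1 hM).2 (Int.floor_nonneg.mpr hY)
  have hM' : (0 : ℝ) < ((|D| * r ^ 2 : ℤ) : ℝ) := by exact_mod_cast hM
  calc (S.card : ℝ) ≤ _ := by exact_mod_cast hcard
    _ ≤ _ := h2
    _ ≤ Y / ((|D| * r ^ 2 : ℤ) : ℝ) + 1 := by
      gcongr
      simpa using Int.floor_le Y
    _ = _ := by push_cast; rfl

/-- A reduced fraction `r / s > 1` is the root of many forms in `posForms Q T`. -/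
lemma le_card_fiber (hD : D ≠ 0)
    (hk : ∀ f : ℤ × ℤ × ℤ, ProperEquiv f Q ↔
      ∃ p q r s : ℤ, p * s - q * r = 1 ∧ f = prodForm r s (D * p + k * r) (D * q + k * s))
    {S : Finset (ℤ × ℤ × ℤ)} {r s : ℤ}
    (hS : ∀ f ∈ posForms Q T, rootNum D f = r → rootDen D f = s → f ∈ S)
    (hs : 0 < s) (hsr : s < r) (hcop : IsCoprime r s) :
    T / ((|D| : ℤ) * (r : ℝ) ^ 2) - 3 ≤ (S.card : ℝ) := by
  obtain ⟨x, y, hxy⟩ := hcop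
  have hr : 0 < r := hs.trans hsr
  have hM : 0 < |D| * r ^ 2 := mul_pos (abs_pos.mpr hD) (pow_pos hr 2)
  have hcard : ((Finset.Ioc (|D| * r) ⌊T⌋).filter
      (· ≡ r * (D * y + k * r) [ZMOD |D| * r ^ 2])).card ≤ S.card := by
    refine (Finset.card_le_card (t := S.image (fun f => f.1)) ?_).trans Finset.card_image_le
    intro a ha
    rw [Finset.mem_filter, Finset.mem_Ioc] at ha
    obtain ⟨f, hf, h1, h2, h3⟩ := exists_mem_posForms (q := -x) hk (by linear_combination hxy)
      hs hsr ha.1.1 (Int.le_floor.mp ha.1.2) ha.2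
    exact Finset.mem_image.mpr ⟨f, hS f hf h1 h2, h3⟩
  have h2 := (card_Ioc_filter_modEq_bounds (|D| * r) ⌊T⌋ (r * (D * y + k * r)) hM).1
  have hD1 : (1 : ℝ) ≤ ((|D| : ℤ) : ℝ) := by exact_mod_cast abs_pos.mpr hD
  have hr1 : (1 : ℝ) ≤ (r : ℝ) := by exact_mod_cast hr
  refine le_trans ?_ (h2.trans (by exact_mod_cast hcard))
  have hfl := Int.lt_floor_add_one T
  have hpos : (0 : ℝ) < ((|D| : ℤ) : ℝ) * (r : ℝ) ^ 2 := by positivity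
  have h4 : T - 2 * (((|D| : ℤ) : ℝ) * (r : ℝ) ^ 2) ≤ (⌊T⌋ : ℝ) - ((|D| * r : ℤ) : ℝ) := by
    rw [Int.cast_mul]
    nlinarith [mul_le_mul hD1 hr1 zero_le_one (by linarith)]
  have h5 := div_le_div_of_nonneg_right h4 hpos.le
  rw [sub_div, mul_div_cancel_right₀ _ hpos.ne'] at h5
  have h6 : ((|D| * r ^ 2 : ℤ) : ℝ) = ((|D| : ℤ) : ℝ) * (r : ℝ) ^ 2 := by push_cast; rfl
  rw [h6]
  linarith

lemma card_filter_coprime_range_add_le (r d : ℕ) :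
    ((Finset.range (r + d)).filter r.Coprime).card ≤ r.totient + d := by
  have : (Finset.range (r + d)).filter r.Coprime ⊆
      (Finset.range r).filter r.Coprime ∪ Finset.Ico r (r + d) := by
    intro x hx
    simp only [Finset.mem_filter, Finset.mem_range, Finset.mem_union, Finset.mem_Ico] at hx ⊢
    rcases lt_or_ge x r with h | h
    · exact Or.inl ⟨h, hx.2⟩
    · exact Or.inr ⟨h, hx.1⟩
  refine (Finset.card_le_card this).trans ((Finset.card_union_le _ _).trans ?_)
  rw [Nat.card_Ico, Nat.add_sub_cancel_left]
  rfl

lemma card_row_le (hD : D ≠ 0)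
    (hk : ∀ f : ℤ × ℤ × ℤ, ProperEquiv f Q ↔
      ∃ p q r s : ℤ, p * s - q * r = 1 ∧ f = prodForm r s (D * p + k * r) (D * q + k * s))
    {S : Finset (ℤ × ℤ × ℤ)} (hS : ∀ f ∈ S, f ∈ posForms Q T) {r : ℕ}
    (hr : ∀ f ∈ S, rootNum D f = r) {Y : ℝ} (hY : 0 ≤ Y)
    (hSY : ∀ f ∈ S, (f.1 : ℝ) ≤ Y) :
    (S.card : ℝ) ≤ ((r.totient : ℝ) + D.natAbs) * (Y / (D.natAbs * (r : ℝ) ^ 2) + 1) := by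
  have hmaps : ∀ f ∈ S, (rootDen D f).toNat ∈
      (Finset.range (r + D.natAbs)).filter r.Coprime := by
    intro f hf
    obtain ⟨p, q, r', s, h⟩ := exists_isPosRep hk (hS f hf)
    obtain rfl : r' = r := h.rootNum_eq ▸ hr f hf
    rw [h.rootDen_eq, Finset.mem_filter, Finset.mem_range]
    have h1 := h.den_lt (hS f hf).2.1
    have h2 := h.s_pos
    have h4 := Int.natCast_natAbs D
    refine ⟨by omega, ?_⟩
    have h3 := h.isCoprime
    rw [← Int.toNat_of_nonneg h2.le] at h3
    exact Nat.isCoprime_iff_coprime.mp h3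
  have habs : ((|D| : ℤ) : ℝ) = (D.natAbs : ℝ) := by rw [Nat.cast_natAbs]
  rw [Finset.card_eq_sum_card_fiberwise hmaps, Nat.cast_sum]
  have hle : ∀ s ∈ (Finset.range (r + D.natAbs)).filter r.Coprime,
      ((S.filter fun f => (rootDen D f).toNat = s).card : ℝ) ≤
        Y / (D.natAbs * (r : ℝ) ^ 2) + 1 := by
    intro s _
    have := card_fiber_le (S := S.filter fun f => (rootDen D f).toNat = s) (r := r) (s := s)
      hD hk (fun f hf => hS f (Finset.mem_filter.mp hf).1)
      (fun f hf => hr f (Finset.mem_filter.mp hf).1) ?_ hY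
      (fun f hf => hSY f (Finset.mem_filter.mp hf).1)
    · rw [habs, Int.cast_natCast] at this
      exact this
    · intro f hf
      rw [Finset.mem_filter] at hf
      obtain ⟨p, q, r', s', h⟩ := exists_isPosRep hk (hS f hf.1)
      rw [← hf.2, h.rootDen_eq, Int.toNat_of_nonneg h.s_pos.le]
  refine (Finset.sum_le_card_nsmul _ _ _ hle).trans ?_
  rw [nsmul_eq_mul]
  gcongr
  exact_mod_cast card_filter_coprime_range_add_le r D.natAbs

lemma le_card_row (hD : D ≠ 0)
    (hk : ∀ f : ℤ × ℤ × ℤ, ProperEquiv f Q ↔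
      ∃ p q r s : ℤ, p * s - q * r = 1 ∧ f = prodForm r s (D * p + k * r) (D * q + k * s))
    (hT : 0 ≤ T) {S : Finset (ℤ × ℤ × ℤ)} {r : ℕ} (hr0 : 0 < r)
    (hS : ∀ f ∈ posForms Q T, rootNum D f = r → f ∈ S) :
    (r.totient : ℝ) * (T / (D.natAbs * (r : ℝ) ^ 2)) - 3 * r - T * ((r : ℝ) ^ 2)⁻¹ ≤
      (S.card : ℝ) := by
  have hd1 : (1 : ℝ) ≤ (D.natAbs : ℝ) := by exact_mod_cast Int.natAbs_pos.mpr hD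
  have hphi : (r.totient : ℝ) ≤ r := by exact_mod_cast Nat.totient_le r
  have habs : ((|D| : ℤ) : ℝ) = (D.natAbs : ℝ) := by rw [Nat.cast_natAbs]
  rcases eq_or_lt_of_le (Nat.succ_le_of_lt hr0) with h1 | h1
  · obtain rfl : r = 1 := by omega
    have : T / (D.natAbs : ℝ) ≤ T := div_le_self hT hd1
    have : (0 : ℝ) ≤ S.card := by positivity
    simp only [Nat.totient_one, Nat.cast_one, one_pow, mul_one, inv_one, one_mul]
    linarith
  have hsub : ((Finset.range r).filter r.Coprime).card • (T / (D.natAbs * (r : ℝ) ^ 2) - 3) ≤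
      ∑ s ∈ (Finset.range r).filter r.Coprime,
        ((S.filter fun f => (rootDen D f).toNat = s).card : ℝ) := by
    refine Finset.card_nsmul_le_sum _ _ _ fun s hs => ?_
    rw [Finset.mem_filter, Finset.mem_range] at hs
    have hs0 : 0 < s := by
      rcases Nat.eq_zero_or_pos s with rfl | h
      · have := (Nat.coprime_zero_right r).mp hs.2
        omega
      · exact h
    have := le_card_fiber (S := S.filter fun f => (rootDen D f).toNat = s) (r := r) (s := s)
      (T := T) hD hk ?_ (by exact_mod_cast hs0) (by exact_mod_cast hs.1)
      (Nat.isCoprime_iff_coprime.mpr hs.2)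
    · rw [habs, Int.cast_natCast] at this
      exact this
    · intro f hf h2 h3
      exact Finset.mem_filter.mpr ⟨hS f hf h2, by rw [h3]; simp⟩
  have hsum : ∑ s ∈ (Finset.range r).filter r.Coprime,
      ((S.filter fun f => (rootDen D f).toNat = s).card : ℝ) ≤ S.card := by
    rw [← Nat.cast_sum, Finset.sum_card_fiberwise_eq_card_filter]
    exact_mod_cast Finset.card_filter_le _ _
  have hcard : ((Finset.range r).filter r.Coprime).card = r.totient := rfl
  rw [nsmul_eq_mul, hcard] at hsub
  have : 0 ≤ T * ((r : ℝ) ^ 2)⁻¹ := by positivity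
  linarith

end Counting

lemma injOn_outer_coeffs (Δ : ℤ) : Set.InjOn (fun f : ℤ × ℤ × ℤ => (f.1, f.2.2))
    {f | 0 ≤ f.2.1 ∧ f.2.1 ^ 2 - 4 * f.1 * f.2.2 = Δ} := by
  rintro ⟨a, b, c⟩ ⟨hb, hd⟩ ⟨a', b', c'⟩ ⟨hb', hd'⟩ h
  simp only [Prod.mk.injEq] at h hb hd hb' hd' ⊢
  obtain ⟨rfl, rfl⟩ := h
  refine ⟨rfl, ?_, rfl⟩
  exact (pow_left_inj₀ hb hb' two_ne_zero).mp (by linarith)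

lemma mem_Icc_floor_of_abs_le {a : ℤ} {T : ℝ} (h : |(a : ℝ)| ≤ T) :
    a ∈ Finset.Icc (-⌊T⌋) ⌊T⌋ := by
  rw [abs_le] at h
  refine Finset.mem_Icc.mpr ⟨?_, Int.le_floor.mpr h.2⟩
  rw [neg_le]
  exact Int.le_floor.mpr (by push_cast; linarith)

lemma finite_forms (Δ : ℤ) (T : ℝ) : {f : ℤ × ℤ × ℤ | |(f.1 : ℝ)| ≤ T ∧ |(f.2.2 : ℝ)| ≤ T ∧
    0 ≤ f.2.1 ∧ f.2.1 ^ 2 - 4 * f.1 * f.2.2 = Δ}.Finite := by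
  refine Set.Finite.of_injOn (t := ↑(Finset.Icc (-⌊T⌋) ⌊T⌋ ×ˢ Finset.Icc (-⌊T⌋) ⌊T⌋))
    (f := fun f => (f.1, f.2.2)) ?_ ((injOn_outer_coeffs Δ).mono fun f hf => hf.2.2)
    (Finset.finite_toSet _)
  intro f hf
  exact Finset.mem_coe.mpr (Finset.mem_product.mpr
    ⟨mem_Icc_floor_of_abs_le hf.1, mem_Icc_floor_of_abs_le hf.2.1⟩)

lemma posForms_subset (Q : ℤ × ℤ × ℤ) (T : ℝ) :
    posForms Q T ⊆ {f | |(f.1 : ℝ)| ≤ T ∧ |(f.2.2 : ℝ)| ≤ T ∧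
      0 ≤ f.2.1 ∧ f.2.1 ^ 2 - 4 * f.1 * f.2.2 = Q.2.1 ^ 2 - 4 * Q.1 * Q.2.2} := by
  rintro f ⟨h1, h2, h3, h4, h5⟩
  have h1' : (0 : ℝ) < f.2.2 := by exact_mod_cast h1
  have h2' : (f.2.2 : ℝ) < f.1 := by exact_mod_cast h2
  refine ⟨?_, ?_, h3.le, h5.disc_eq⟩
  · rw [abs_of_pos (by linarith)]; exact h4
  · rw [abs_of_pos h1']; linarith

lemma finite_posForms (Q : ℤ × ℤ × ℤ) (T : ℝ) : (posForms Q T).Finite :=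
  (finite_forms _ T).subset (posForms_subset Q T)

section Counting

variable {Q : ℤ × ℤ × ℤ} {D : ℤ} {T : ℝ}

lemma sum_Ioc_inv_sq_le_two (R : ℕ) : ∑ r ∈ Finset.Ioc 0 R, ((r : ℝ) ^ 2)⁻¹ ≤ 2 := by
  have h := sum_Ioo_inv_sq_le (α := ℝ) 0 (R + 1)
  have : Finset.Ioo 0 (R + 1) = Finset.Ioc 0 R := by ext; simp
  rw [this] at h
  simpa using h

/-- The forms in `posForms Q T` one of whose two roots has small numerator. -/
lemma abs_card_rootNum_le_sub_le (hD : D ≠ 0) (hQ : Q.2.1 ^ 2 - 4 * Q.1 * Q.2.2 = D ^ 2)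
    {R : ℕ} (hT : 1 ≤ T) (hR : (R : ℝ) ^ 2 ≤ T) {S : Finset (ℤ × ℤ × ℤ)}
    (hS : ∀ f, f ∈ S ↔ f ∈ posForms Q T ∧ rootNum D f ≤ R) :
    |(S.card : ℝ) - T / D.natAbs * ∑ r ∈ Finset.Ioc 0 R, (Nat.totient r : ℝ) / (r : ℝ) ^ 2| ≤
      (5 + D.natAbs) * T := by
  obtain ⟨k, hk⟩ := exists_forall_properEquiv_iff hD hQ
  have hd1 : (1 : ℝ) ≤ (D.natAbs : ℝ) := by exact_mod_cast Int.natAbs_pos.mpr hD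
  have hR0 : (R : ℝ) ≤ T := by
    rcases Nat.eq_zero_or_pos R with rfl | h
    · simp only [Nat.cast_zero]; linarith
    · have : (1 : ℝ) ≤ R := by exact_mod_cast h
      nlinarith
  have hsq := sum_Ioc_inv_sq_le_two R
  have hmaps : ∀ f ∈ S, (rootNum D f).toNat ∈ Finset.Ioc 0 R := by
    intro f hf
    obtain ⟨h1, h2⟩ := (hS f).mp hf
    obtain ⟨p, q, r, s, h⟩ := exists_isPosRep hk h1
    have h3 := h.r_pos
    rw [← h.rootNum_eq] at h3
    rw [Finset.mem_Ioc]
    omega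
  have hcard : (S.card : ℝ) = ∑ r ∈ Finset.Ioc 0 R,
      ((S.filter fun f => (rootNum D f).toNat = r).card : ℝ) := by
    rw [Finset.card_eq_sum_card_fiberwise hmaps, Nat.cast_sum]
  have hupper : ∀ r ∈ Finset.Ioc 0 R,
      ((S.filter fun f => (rootNum D f).toNat = r).card : ℝ) ≤
        T / D.natAbs * ((Nat.totient r : ℝ) / (r : ℝ) ^ 2) + R + T * ((r : ℝ) ^ 2)⁻¹
          + D.natAbs := by
    intro r hr
    rw [Finset.mem_Ioc] at hr
    have h := card_row_le (S := S.filter fun f => (rootNum D f).toNat = r) (r := r) (Y := T) hD hk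
      (fun f hf => ((hS f).mp (Finset.mem_filter.mp hf).1).1) ?_ (by linarith)
      (fun f hf => ((hS f).mp (Finset.mem_filter.mp hf).1).1.2.2.2.1)
    · refine h.trans ?_
      have h1 : (r.totient : ℝ) ≤ R := by
        exact_mod_cast (Nat.totient_le r).trans hr.2
      have h2 : (D.natAbs : ℝ) * (T / (D.natAbs * (r : ℝ) ^ 2)) = T * ((r : ℝ) ^ 2)⁻¹ := by
        have : (r : ℝ) ≠ 0 := by exact_mod_cast hr.1.ne'
        field_simp
      have h3 : (r.totient : ℝ) * (T / (D.natAbs * (r : ℝ) ^ 2)) =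
          T / D.natAbs * ((Nat.totient r : ℝ) / (r : ℝ) ^ 2) := by
        have : (r : ℝ) ≠ 0 := by exact_mod_cast hr.1.ne'
        field_simp
      linarith
    · intro f hf
      rw [Finset.mem_filter] at hf
      have := Finset.mem_Ioc.mp (hmaps f hf.1)
      omega
  have hlower : ∀ r ∈ Finset.Ioc 0 R,
      T / D.natAbs * ((Nat.totient r : ℝ) / (r : ℝ) ^ 2) - 3 * R - T * ((r : ℝ) ^ 2)⁻¹ ≤
      ((S.filter fun f => (rootNum D f).toNat = r).card : ℝ) := by
    intro r hr
    rw [Finset.mem_Ioc] at hr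
    have h := le_card_row (S := S.filter fun f => (rootNum D f).toNat = r) (r := r) hD hk
      (by linarith : 0 ≤ T) hr.1 ?_
    · refine le_trans ?_ h
      have h1 : (r : ℝ) ≤ R := by exact_mod_cast hr.2
      have h3 : (r.totient : ℝ) * (T / (D.natAbs * (r : ℝ) ^ 2)) =
          T / D.natAbs * ((Nat.totient r : ℝ) / (r : ℝ) ^ 2) := by
        have : (r : ℝ) ≠ 0 := by exact_mod_cast hr.1.ne'
        field_simp
      linarith
    · intro f hf h2
      refine Finset.mem_filter.mpr ⟨(hS f).mpr ⟨hf, ?_⟩, ?_⟩ <;> omega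
  have hU := Finset.sum_le_sum hupper
  have hL := Finset.sum_le_sum hlower
  simp only [Finset.sum_add_distrib, Finset.sum_sub_distrib, ← Finset.mul_sum,
    Finset.sum_const, Nat.card_Ioc, nsmul_eq_mul, ← hcard] at hU hL
  simp only [Nat.sub_zero] at hU hL
  have hT2 := mul_le_mul_of_nonneg_left hsq (by linarith : 0 ≤ T)
  have hRd : (R : ℝ) * D.natAbs ≤ T * D.natAbs := by gcongr
  rw [abs_le]
  constructor
  · nlinarith
  · nlinarith

/-- Few forms in `posForms Q T` have both roots of small numerator. -/
lemma card_both_rootNum_le (hD : D ≠ 0) (hQ : Q.2.1 ^ 2 - 4 * Q.1 * Q.2.2 = D ^ 2)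
    {R : ℕ} (hR : (R : ℝ) ^ 2 ≤ T) {S : Finset (ℤ × ℤ × ℤ)}
    (hS : ∀ f ∈ S, f ∈ posForms Q T ∧ rootNum D f ≤ R ∧ rootNum (-D) f ≤ R) :
    (S.card : ℝ) ≤ 2 * (1 + D.natAbs) * T := by
  obtain ⟨k, hk⟩ := exists_forall_properEquiv_iff hD hQ
  have hd1 : (1 : ℝ) ≤ (D.natAbs : ℝ) := by exact_mod_cast Int.natAbs_pos.mpr hD
  have hmaps : ∀ f ∈ S, (rootNum D f).toNat ∈ Finset.Ioc 0 R := by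
    intro f hf
    obtain ⟨h1, h2, -⟩ := hS f hf
    obtain ⟨p, q, r, s, h⟩ := exists_isPosRep hk h1
    have h3 := h.r_pos
    rw [← h.rootNum_eq] at h3
    rw [Finset.mem_Ioc]
    omega
  have hupper : ∀ r ∈ Finset.Ioc 0 R,
      ((S.filter fun f => (rootNum D f).toNat = r).card : ℝ) ≤ 2 * (1 + D.natAbs) * R := by
    intro r hr
    rw [Finset.mem_Ioc] at hr
    have hr1 : (1 : ℝ) ≤ r := by exact_mod_cast hr.1
    have hrR : (r : ℝ) ≤ R := by exact_mod_cast hr.2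
    have hnum : ∀ f ∈ S.filter fun f => (rootNum D f).toNat = r, rootNum D f = r := by
      intro f hf
      rw [Finset.mem_filter] at hf
      have := Finset.mem_Ioc.mp (hmaps f hf.1)
      omega
    have h := card_row_le (S := S.filter fun f => (rootNum D f).toNat = r) (r := r)
      (Y := D.natAbs * (r * R)) hD hk
      (fun f hf => (hS f (Finset.mem_filter.mp hf).1).1) hnum (by positivity) ?_
    · refine h.trans ?_
      have h1 : (r.totient : ℝ) ≤ r := by exact_mod_cast Nat.totient_le r
      have h2 : (D.natAbs : ℝ) * (r * R) / (D.natAbs * (r : ℝ) ^ 2) + 1 = (R + r) / r := by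
        field_simp
      rw [h2]
      have h3 : (r.totient : ℝ) + D.natAbs ≤ (1 + D.natAbs) * r := by nlinarith
      calc ((r.totient : ℝ) + D.natAbs) * (((R : ℝ) + r) / r)
          ≤ (1 + (D.natAbs : ℝ)) * r * (((R : ℝ) + r) / r) := by gcongr
        _ = (1 + (D.natAbs : ℝ)) * ((R : ℝ) + r) := by field_simp
        _ ≤ (1 + (D.natAbs : ℝ)) * ((R : ℝ) + R) := by gcongr
        _ = 2 * (1 + (D.natAbs : ℝ)) * R := by ring
    · intro f hf
      obtain ⟨h1, h2, h3⟩ := hS f (Finset.mem_filter.mp hf).1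
      obtain ⟨p, q, r', s, hrep⟩ := exists_isPosRep hk h1
      have h4 := hrep.fst_le hD
      rw [hnum f hf] at h4
      have h5 : f.1 ≤ (D.natAbs : ℤ) * (r * R) := by
        rw [Int.natCast_natAbs]
        exact h4.trans (by gcongr)
      have h6 : (f.1 : ℝ) ≤ (((D.natAbs : ℤ) * (r * R) : ℤ) : ℝ) := Int.cast_le.mpr h5
      simpa only [Int.cast_mul, Int.cast_natCast] using h6
  rw [Finset.card_eq_sum_card_fiberwise hmaps, Nat.cast_sum]
  refine (Finset.sum_le_card_nsmul _ _ _ hupper).trans ?_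
  rw [Nat.card_Ioc, nsmul_eq_mul, Nat.sub_zero]
  nlinarith

lemma abs_ncard_posForms_sub_le (hD : D ≠ 0) (hQ : Q.2.1 ^ 2 - 4 * Q.1 * Q.2.2 = D ^ 2)
    (hT : 1 ≤ T) :
    |((posForms Q T).ncard : ℝ) - 2 * (T / D.natAbs *
      ∑ r ∈ Finset.Ioc 0 ⌊√T⌋₊, (Nat.totient r : ℝ) / (r : ℝ) ^ 2)| ≤
      (12 + 4 * D.natAbs) * T := by
  set R := ⌊√T⌋₊ with hRdef
  have hR : (R : ℝ) ^ 2 ≤ T := by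
    have h1 : (R : ℝ) ≤ √T := Nat.floor_le (Real.sqrt_nonneg T)
    calc (R : ℝ) ^ 2 ≤ √T ^ 2 := by gcongr
      _ = T := Real.sq_sqrt (by linarith)
  have hR' : T < ((R : ℝ) + 1) ^ 2 := by
    have h1 : √T < R + 1 := Nat.lt_floor_add_one _
    calc T = √T ^ 2 := (Real.sq_sqrt (by linarith)).symm
      _ < _ := by gcongr
  set P := (finite_posForms Q T).toFinset with hP
  have hmem : ∀ f, f ∈ P ↔ f ∈ posForms Q T := fun f => Set.Finite.mem_toFinset _
  set A := P.filter fun f => rootNum D f ≤ R with hA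
  set B := P.filter fun f => rootNum (-D) f ≤ R with hB
  have hcardA := abs_card_rootNum_le_sub_le (S := A) hD hQ hT hR
    fun f => by rw [hA, Finset.mem_filter, hmem]
  have hcardB := abs_card_rootNum_le_sub_le (S := B) (neg_ne_zero.mpr hD)
    (by rw [neg_sq]; exact hQ) hT hR fun f => by rw [hB, Finset.mem_filter, hmem]
  have hcardI := card_both_rootNum_le (S := A ∩ B) hD hQ hR fun f hf => by
    rw [hA, hB, Finset.mem_inter, Finset.mem_filter, Finset.mem_filter, hmem] at hf
    exact ⟨hf.1.1, hf.1.2, hf.2.2⟩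
  obtain ⟨k, hk⟩ := exists_forall_properEquiv_iff hD hQ
  have hunion : A ∪ B = P := by
    ext f
    rw [hA, hB, Finset.mem_union, Finset.mem_filter, Finset.mem_filter]
    refine ⟨fun h => h.elim And.left And.left, fun hf => ?_⟩
    by_contra! hc
    have h1 := hc.1 hf
    have h2 := hc.2 hf
    have hf' := (hmem f).mp hf
    obtain ⟨p, q, r, s, h⟩ := exists_isPosRep hk hf'
    have h3 := h.rootNum_mul_rootNum_neg_le
    have h4 : ((R : ℤ) + 1) ^ 2 ≤ f.1 := by nlinarith
    have h5 : ((R : ℝ) + 1) ^ 2 ≤ f.1 := by exact_mod_cast h4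
    have h6 := hf'.2.2.2.1
    linarith
  have hcard : (P.card : ℝ) + (A ∩ B).card = A.card + B.card := by
    have := Finset.card_union_add_card_inter A B
    rw [hunion] at this
    exact_mod_cast this
  rw [Set.ncard_eq_toFinset_card _ (finite_posForms Q T), ← hP]
  rw [Int.natAbs_neg] at hcardB
  have h0 : (0 : ℝ) ≤ (A ∩ B).card := by positivity
  rw [abs_le] at hcardA hcardB ⊢
  constructor <;> linarith

/-- Up to `O(T)` forms, those counted by `FTQ` are positive forms or images of positive forms
under `negRot`. -/
lemma abs_FTQ_sub_le (hD : D ≠ 0) (hQ : Q.2.1 ^ 2 - 4 * Q.1 * Q.2.2 = D ^ 2) (hT : 1 ≤ T) :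
    |(FTQ Q T : ℝ) - ((posForms Q T).ncard + (posForms (negRot Q) T).ncard)| ≤
      (6 + (2 * (D : ℝ) ^ 2 + 1) ^ 2) * T := by
  set F : Set (ℤ × ℤ × ℤ) := {f | |(f.1 : ℝ)| ≤ T ∧ |(f.2.2 : ℝ)| ≤ T ∧
    f.2.2 < f.1 ∧ 0 ≤ f.2.1 ∧ ProperEquiv f Q} with hF
  have hdisc : ∀ f ∈ F, f.2.1 ^ 2 - 4 * f.1 * f.2.2 = D ^ 2 := fun f hf => by
    rw [hf.2.2.2.2.disc_eq, hQ]
  have hFsub : F ⊆ {f | 0 ≤ f.2.1 ∧ f.2.1 ^ 2 - 4 * f.1 * f.2.2 = D ^ 2} :=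
    fun f hf => ⟨hf.2.2.2.1, hdisc f hf⟩
  have hfin : F.Finite := (finite_forms (D ^ 2) T).subset
    fun f hf => ⟨hf.1, hf.2.1, hf.2.2.2.1, hdisc f hf⟩
  have hD2 : 0 < D ^ 2 := by positivity
  have hpos : posForms Q T = {f ∈ F | 0 < f.2.2} := by
    ext f
    constructor
    · intro hf
      have h := posForms_subset Q T hf
      exact ⟨⟨h.1, h.2.1, hf.2.1, hf.2.2.1.le, hf.2.2.2.2⟩, hf.1⟩
    · rintro ⟨hf, hc⟩
      have h1 := hdisc f hf
      have h2 : 0 < f.1 * f.2.2 := mul_pos (hc.trans hf.2.2.1) hc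
      refine ⟨hc, hf.2.2.1, lt_of_le_of_ne hf.2.2.2.1 ?_, (le_abs_self _).trans hf.1,
        hf.2.2.2.2⟩
      intro h0
      rw [← h0] at h1
      nlinarith
  have hneg : negRot '' posForms (negRot Q) T = {f ∈ F | f.1 < 0} := by
    ext f
    constructor
    · rintro ⟨f, hf, rfl⟩
      have h := posForms_subset _ T hf
      refine ⟨⟨?_, ?_, ?_, hf.2.2.1.le, ?_⟩, ?_⟩
      · simpa [negRot] using h.2.1
      · simpa [negRot] using h.1
      · simpa [negRot] using hf.2.1
      · simpa [negRot_negRot] using hf.2.2.2.2.negRot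
      · simpa [negRot] using hf.1
    · rintro ⟨hf, ha⟩
      refine ⟨negRot f, ⟨?_, ?_, ?_, ?_, hf.2.2.2.2.negRot⟩, negRot_negRot f⟩
      · simpa [negRot] using ha
      · simpa [negRot] using hf.2.2.1
      · refine lt_of_le_of_ne hf.2.2.2.1 ?_
        intro h0
        have h1 := hdisc f hf
        change 0 = f.2.1 at h0
        rw [← h0] at h1
        have h2 : 0 < f.1 * f.2.2 := mul_pos_of_neg_of_neg ha (hf.2.2.1.trans ha)
        nlinarith
      · have := (neg_le_abs _).trans hf.2.1
        simpa [negRot] using this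
  have hnegcard : (negRot '' posForms (negRot Q) T).ncard = (posForms (negRot Q) T).ncard :=
    Set.ncard_image_of_injective _ (Function.LeftInverse.injective negRot_negRot)
  set E := {f ∈ F | f.2.2 ≤ 0 ∧ 0 ≤ f.1} with hE
  have hdecomp : F = posForms Q T ∪ negRot '' posForms (negRot Q) T ∪ E := by
    rw [hpos, hneg, hE]
    ext f
    simp only [Set.mem_union, Set.mem_sep_iff]
    constructor
    · intro hf
      rcases lt_or_ge 0 f.2.2 with h | h
      · exact Or.inl (Or.inl ⟨hf, h⟩)
      · rcases lt_or_ge f.1 0 with h' | h'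
        · exact Or.inl (Or.inr ⟨hf, h'⟩)
        · exact Or.inr ⟨hf, h, h'⟩
    · rintro ((h | h) | h) <;> exact h.1
  have hdisj1 : Disjoint (posForms Q T) (negRot '' posForms (negRot Q) T) := by
    rw [hpos, hneg, Set.disjoint_left]
    rintro f ⟨hf, h1⟩ ⟨-, h2⟩
    have := hf.2.2.1
    omega
  have hdisj2 : Disjoint (posForms Q T ∪ negRot '' posForms (negRot Q) T) E := by
    rw [hpos, hneg, Set.disjoint_left]
    rintro f (⟨hf, h1⟩ | ⟨hf, h1⟩) ⟨-, h2, h3⟩ <;> omega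
  have hfinneg := (finite_posForms (negRot Q) T).image negRot
  have hEfin : E.Finite := hfin.subset (Set.sep_subset _ _)
  have hcard : FTQ Q T =
      (posForms Q T).ncard + (posForms (negRot Q) T).ncard + E.ncard := by
    rw [FTQ, ← hF, ← hnegcard, ← Set.ncard_union_eq hdisj1 (finite_posForms Q T) hfinneg,
      ← Set.ncard_union_eq hdisj2 ((finite_posForms Q T).union hfinneg) hEfin, ← hdecomp]
  set I := Finset.Icc (-⌊T⌋) ⌊T⌋ with hI
  set J := Finset.Icc (-D ^ 2) (D ^ 2) with hJ
  have hEcard : E.ncard ≤ (({0} ×ˢ I ∪ I ×ˢ {0}) ∪ J ×ˢ J : Finset (ℤ × ℤ)).card := by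
    rw [← Set.ncard_coe_finset]
    refine Set.ncard_le_ncard_of_injOn (fun f => (f.1, f.2.2)) ?_
      ((injOn_outer_coeffs (D ^ 2)).mono ((Set.sep_subset _ _).trans hFsub))
      (Finset.finite_toSet _)
    rintro f ⟨hf, h1, h2⟩
    have ha := mem_Icc_floor_of_abs_le hf.1
    have hc := mem_Icc_floor_of_abs_le hf.2.1
    simp only [Finset.coe_union, Finset.coe_product, Set.mem_union, Set.mem_prod,
      Finset.mem_coe, Finset.mem_singleton]
    rcases h2.eq_or_lt with h2' | h2'
    · exact Or.inl (Or.inl ⟨h2'.symm, hc⟩)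
    rcases h1.eq_or_lt with h1' | h1'
    · exact Or.inl (Or.inr ⟨ha, h1'⟩)
    · right
      have h3 := hdisc f hf
      have h4 := sq_nonneg f.2.1
      rw [hJ, Finset.mem_Icc, Finset.mem_Icc]
      refine ⟨⟨?_, ?_⟩, ?_, ?_⟩ <;> nlinarith
  have hIcard : (I.card : ℝ) ≤ 3 * T := by
    have h1 : (I.card : ℤ) = 2 * ⌊T⌋ + 1 := by
      have : 0 ≤ ⌊T⌋ := Int.floor_nonneg.mpr (by linarith)
      rw [hI, Int.card_Icc, Int.toNat_of_nonneg (by omega)]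
      ring
    have h2 : (I.card : ℝ) = 2 * ⌊T⌋ + 1 := by exact_mod_cast h1
    have := Int.floor_le T
    linarith
  have hJcard : (J.card : ℝ) = 2 * (D : ℝ) ^ 2 + 1 := by
    have h1 : (J.card : ℤ) = 2 * D ^ 2 + 1 := by
      rw [hJ, Int.card_Icc, Int.toNat_of_nonneg (by nlinarith)]
      ring
    exact_mod_cast h1
  have hbox : (E.ncard : ℝ) ≤ I.card + I.card + J.card * J.card := by
    have h1 := (hEcard.trans (Finset.card_union_le _ _)).trans
      (Nat.add_le_add_right (Finset.card_union_le _ _) _)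
    simp only [Finset.card_product, Finset.card_singleton, one_mul, mul_one] at h1
    exact_mod_cast h1
  rw [hcard]
  push_cast
  rw [add_sub_cancel_left, abs_of_nonneg (by positivity)]
  rw [hJcard] at hbox
  nlinarith [sq_nonneg (2 * (D : ℝ) ^ 2 + 1)]

end Counting

lemma tendsto_log_floor_sqrt_div_log :
    Tendsto (fun T : ℝ => log (⌊√T⌋₊ : ℝ) / log T) atTop (nhds (1 / 2)) := by
  have hfl : Tendsto (fun T : ℝ => (⌊√T⌋₊ : ℝ) / √T) atTop (nhds 1) :=
    (tendsto_nat_floor_div_atTop (R := ℝ)).comp tendsto_sqrt_atTop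
  have h1 : Tendsto (fun T : ℝ => log ((⌊√T⌋₊ : ℝ) / √T) / log T) atTop (nhds 0) :=
    (by simpa using hfl.log one_ne_zero : Tendsto (fun T : ℝ => log ((⌊√T⌋₊ : ℝ) / √T)) atTop
      (nhds 0)).div_atTop tendsto_log_atTop
  have h2 := h1.add_const (1 / 2 : ℝ)
  rw [zero_add] at h2
  refine h2.congr' ?_
  filter_upwards [eventually_gt_atTop 1] with T hT
  have hs : 1 ≤ √T := Real.one_le_sqrt.mpr hT.le
  have hf : (0 : ℝ) < (⌊√T⌋₊ : ℝ) := by exact_mod_cast Nat.floor_pos.mpr hs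
  have hl : 0 < log T := log_pos hT
  rw [log_div hf.ne' (by linarith), log_sqrt (by linarith)]
  field_simp
  ring

lemma tendsto_sum_totient_floor_sqrt :
    Tendsto (fun T : ℝ => (∑ r ∈ Finset.Ioc 0 ⌊√T⌋₊, (Nat.totient r : ℝ) / (r : ℝ) ^ 2) / log T)
      atTop (nhds (3 / π ^ 2)) := by
  have hfloor : Tendsto (fun T : ℝ => ⌊√T⌋₊) atTop atTop :=
    tendsto_nat_floor_atTop.comp tendsto_sqrt_atTop
  have h := (tendsto_sum_totient_div_sq_div_log.comp hfloor).mul tendsto_log_floor_sqrt_div_log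
  rw [show 6 / π ^ 2 * (1 / 2) = 3 / π ^ 2 by ring] at h
  refine h.congr' ?_
  filter_upwards [hfloor.eventually_ge_atTop 2] with T hT
  have : log (⌊√T⌋₊ : ℝ) ≠ 0 := (log_pos (by exact_mod_cast hT)).ne'
  simp only [Function.comp_apply]
  field_simp

/-- **Theorem 2 (c).** For a positive perfect square `n` and an integral binary quadratic
form `Q` of discriminant `4n`, as `T → ∞` one has
`F_T^Q = 6 T log T / (π² n^{1/2}) + o(T log T)`. -/
theorem orbit_count_split (n : ℤ) (hn : 0 < n) (hsq : ∃ m : ℤ, n = m ^ 2)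
    (Q : ℤ × ℤ × ℤ) (hdisc : Q.2.1 ^ 2 - 4 * Q.1 * Q.2.2 = 4 * n) :
    (fun T : ℝ => (FTQ Q T : ℝ) -
        6 * T * Real.log T / (Real.pi ^ 2 * Real.sqrt (n : ℝ)))
      =o[atTop] (fun T : ℝ => T * Real.log T) := by
  obtain ⟨m₀, hm₀⟩ := hsq
  obtain ⟨m, hm, hnm⟩ : ∃ m : ℤ, 0 < m ∧ n = m ^ 2 :=
    ⟨|m₀|, abs_pos.mpr (by rintro rfl; simp [hm₀] at hn), by rw [sq_abs, hm₀]⟩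
  have hmR : (0 : ℝ) < m := by exact_mod_cast hm
  have hsqrt : √(n : ℝ) = m := by
    rw [hnm, Int.cast_pow, Real.sqrt_sq hmR.le]
  have hD : 2 * m ≠ 0 := by positivity
  have hQ : Q.2.1 ^ 2 - 4 * Q.1 * Q.2.2 = (2 * m) ^ 2 := by rw [hdisc, hnm]; ring
  have hQ' : (negRot Q).2.1 ^ 2 - 4 * (negRot Q).1 * (negRot Q).2.2 = (2 * m) ^ 2 := by
    rw [← hQ]; simp only [negRot]; ring
  have habs : ((2 * m).natAbs : ℝ) = 2 * m := by
    rw [Nat.cast_natAbs, abs_of_pos (by positivity)]; push_cast; rfl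
  set E : ℝ → ℝ := fun T => ∑ r ∈ Finset.Ioc 0 ⌊√T⌋₊, (Nat.totient r : ℝ) / (r : ℝ) ^ 2 with hE
  rw [hsqrt]
  have hlog : (fun T : ℝ => T) =o[atTop] fun T => T * log T := by
    have h := (isBigO_refl (fun T : ℝ => T) atTop).mul_isLittleO
      ((isLittleO_const_left (c := (1 : ℝ)) (g'' := log)).mpr
        (Or.inr (tendsto_norm_atTop_atTop.comp tendsto_log_atTop)))
    simpa using h
  have herr : (fun T : ℝ => (FTQ Q T : ℝ) - 2 * T / m * E T) =o[atTop] fun T => T * log T := by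
    refine IsBigO.trans_isLittleO (IsBigO.of_bound
      ((6 + (2 * ((2 * m : ℤ) : ℝ) ^ 2 + 1) ^ 2) + 2 * (12 + 4 * (2 * m))) ?_) hlog
    filter_upwards [eventually_ge_atTop 1] with T hT
    have h1 := abs_FTQ_sub_le hD hQ hT
    have h2 := abs_ncard_posForms_sub_le hD hQ hT
    have h3 := abs_ncard_posForms_sub_le hD hQ' hT
    rw [habs] at h2 h3
    have h4 : T / (2 * m) * E T = 2 * T / m * E T / 4 := by field_simp; ring
    change |_ - 2 * (T / (2 * m) * E T)| ≤ _ at h2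
    change |_ - 2 * (T / (2 * m) * E T)| ≤ _ at h3
    rw [h4] at h2 h3
    rw [Real.norm_eq_abs, Real.norm_eq_abs, abs_of_pos (by linarith : 0 < T)]
    rw [abs_le] at h1 h2 h3 ⊢
    constructor <;> linarith
  have hmain : (fun T : ℝ => 2 * T / m * E T - 6 * T * log T / (π ^ 2 * m)) =o[atTop]
      fun T => T * log T := by
    have h1 : Tendsto (fun T : ℝ => 2 / m * (E T / log T - 3 / π ^ 2)) atTop (nhds 0) := by
      have h0 := (tendsto_sum_totient_floor_sqrt.sub_const (3 / π ^ 2)).const_mul (2 / (m : ℝ))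
      rwa [sub_self, mul_zero] at h0
    have h2 := ((isLittleO_one_iff ℝ).mpr h1).mul_isBigO
      (isBigO_refl (fun T : ℝ => T * log T) atTop)
    simp only [one_mul] at h2
    refine h2.congr' ?_ EventuallyEq.rfl
    filter_upwards [eventually_gt_atTop 1] with T hT
    have hl := (log_pos hT).ne'
    have hpi := pi_ne_zero
    field_simp
    ring
  refine (herr.add hmain).congr_left fun T => ?_
  ring
end

section
/- Let n be a negative integer and write 4n = f²·d₀ with d₀ < 0 a fundamental discriminant and f a positive integer. Then, as T → ∞, D_T^n = (12T/(ω(d₀)·π·|n|^{1/2}))·h(d₀)·∏_{p^e ∥ f} (σ₁(p^e) − χ_{d₀}(p)·σ₁(p^{e−1})) + o(T), where the product is over primes p with p^e exactly dividing f. -/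
open Filter Real Asymptotics

/-- `DTn n T` is the total number of `D(n)`-pairs `{a, c}` (written with `a > c`) with
`a, c ∈ {-T, …, T}`: sets of two distinct nonzero integers whose product plus `n` is a
perfect square. -/
noncomputable def DTn (n : ℤ) (T : ℝ) : ℕ :=
  Set.ncard {ac : ℤ × ℤ | ac.2 < ac.1 ∧ ac.1 ≠ 0 ∧ ac.2 ≠ 0 ∧
    |(ac.1 : ℝ)| ≤ T ∧ |(ac.2 : ℝ)| ≤ T ∧ ∃ b : ℤ, b ^ 2 = ac.1 * ac.2 + n}

/-- `d` is a fundamental discriminant: the discriminant of a quadratic field, i.e. either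
`d ≡ 1 (mod 4)` and squarefree, or `d = 4m` with `m ≡ 2, 3 (mod 4)` squarefree. -/
def IsFundamentalDiscriminant (d : ℤ) : Prop :=
  (d % 4 = 1 ∧ Squarefree d) ∨
    ∃ m : ℤ, d = 4 * m ∧ (m % 4 = 2 ∨ m % 4 = 3) ∧ Squarefree m

open scoped Classical in
/-- The Kronecker symbol `χ_{d}(p) = (d / p)` attached to a fundamental discriminant `d`,
evaluated at a prime `p`. -/
noncomputable def kroneckerChi (d : ℤ) (p : ℕ) : ℤ :=
  if p = 2 then (if d % 8 = 1 then 1 else if d % 8 = 5 then -1 else 0)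
  else if (p : ℤ) ∣ d then 0
  else if IsSquare ((d : ZMod p)) then 1 else -1

/-- `σ₁(m)`: the sum of the positive divisors of `m`. -/
def sigmaOne (m : ℕ) : ℕ := ∑ d ∈ m.divisors, d

/-- The number of roots of `x ^ 2 - t * x + q` modulo `a`. -/
def rootCount (t q : ℤ) (a : ℕ) : ℕ :=
  ((Finset.range a).filter fun x : ℕ ↦ (a : ℤ) ∣ (x : ℤ) ^ 2 - t * x + q).card

lemma rootCount_eq_card_zmod (t q : ℤ) (a : ℕ) [NeZero a] :
    rootCount t q a = Nat.card {x : ZMod a // x ^ 2 - t * x + q = 0} := by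
  rw [Nat.card_eq_fintype_card, Fintype.card_subtype, rootCount]
  refine Finset.card_bij' (fun x _ ↦ (x : ZMod a)) (fun x _ ↦ x.val) ?_ ?_ ?_ ?_
  · intro x hx
    simp only [Finset.mem_filter, Finset.mem_range, Finset.mem_univ, true_and] at hx ⊢
    rw [← ZMod.intCast_zmod_eq_zero_iff_dvd] at hx
    exact_mod_cast hx.2
  · intro x hx
    simp only [Finset.mem_filter, Finset.mem_range, Finset.mem_univ, true_and] at hx ⊢
    refine ⟨ZMod.val_lt x, ?_⟩
    rw [← ZMod.intCast_zmod_eq_zero_iff_dvd]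
    push_cast
    simpa using hx
  · intro x hx
    simp only [Finset.mem_filter, Finset.mem_range] at hx
    exact ZMod.val_cast_of_lt hx.1
  · intro x hx
    simp

lemma rootCount_shift (t q s : ℤ) (a : ℕ) [NeZero a] :
    rootCount (t + 2 * s) (q + t * s + s ^ 2) a = rootCount t q a := by
  rw [rootCount_eq_card_zmod, rootCount_eq_card_zmod]
  refine Nat.card_congr ((Equiv.subRight (s : ZMod a)).subtypeEquiv fun x ↦ ?_)
  simp only [Equiv.subRight_apply]
  push_cast
  rw [show x ^ 2 - ((t : ZMod a) + 2 * s) * x + (q + t * s + s ^ 2) =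
    (x - s) ^ 2 - t * (x - s) + q by ring]

lemma rootCount_scale_of_coprime (t q : ℤ) {c a : ℕ} [NeZero a] (h : c.Coprime a) :
    rootCount (c * t) (c ^ 2 * q) a = rootCount t q a := by
  rw [rootCount_eq_card_zmod, rootCount_eq_card_zmod]
  symm
  refine Nat.card_congr ((Units.mulLeft (ZMod.unitOfCoprime c h)).subtypeEquiv fun x ↦ ?_)
  have hu : IsUnit ((c : ZMod a) ^ 2) := ((ZMod.unitOfCoprime c h).isUnit).pow 2
  simp only [Units.mulLeft_apply, ZMod.coe_unitOfCoprime]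
  push_cast
  rw [show ((c : ZMod a) * x) ^ 2 - c * t * (c * x) + c ^ 2 * q =
    c ^ 2 * (x ^ 2 - t * x + q) by ring, hu.mul_right_eq_zero]

lemma rootCount_mul (t q : ℤ) {a b : ℕ} [NeZero a] [NeZero b] (h : a.Coprime b) :
    rootCount t q (a * b) = rootCount t q a * rootCount t q b := by
  rw [rootCount_eq_card_zmod, rootCount_eq_card_zmod, rootCount_eq_card_zmod, ← Nat.card_prod]
  refine Nat.card_congr (((ZMod.chineseRemainder h).toEquiv.subtypeEquiv
    (q := fun y : ZMod a × ZMod b ↦ (y.1 ^ 2 - (t : ZMod a) * y.1 + (q : ZMod a) = 0) ∧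
      (y.2 ^ 2 - (t : ZMod b) * y.2 + (q : ZMod b) = 0)) fun x ↦ ?_).trans
    (Equiv.subtypeProdEquivProd (p := fun x : ZMod a ↦ x ^ 2 - (t : ZMod a) * x + (q : ZMod a) = 0)
      (q := fun x : ZMod b ↦ x ^ 2 - (t : ZMod b) * x + (q : ZMod b) = 0)))
  rw [← map_eq_zero_iff (ZMod.chineseRemainder h) (ZMod.chineseRemainder h).injective]
  simp [Prod.ext_iff]

lemma rootCount_scale_prime (t q : ℤ) {p : ℕ} (hp : p.Prime) :
    rootCount (p * t) (p ^ 2 * q) p = 1 := by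
  have := Fact.mk hp
  rw [rootCount_eq_card_zmod, Nat.card_eq_one_iff_unique]
  refine ⟨⟨fun x y ↦ ?_⟩, ⟨⟨0, by simp⟩⟩⟩
  have hx := x.2
  have hy := y.2
  simp at hx hy
  exact Subtype.ext (hx.trans hy.symm)

lemma rootCount_scale_mul_prime (t q : ℤ) {p b : ℕ} [NeZero b] (hp : p.Prime) (h : ¬ p ∣ b) :
    rootCount (p * t) (p ^ 2 * q) (p * b) = rootCount t q b := by
  have hc := (Nat.Prime.coprime_iff_not_dvd hp).2 h
  have : NeZero p := ⟨hp.ne_zero⟩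
  rw [rootCount_mul _ _ hc, rootCount_scale_prime t q hp, rootCount_scale_of_coprime _ _ hc, one_mul]

lemma card_filter_range_mul_of_periodic (P : ℕ → Prop) [DecidablePred P] (b : ℕ)
    (hP : Function.Periodic P b) (k : ℕ) :
    ((Finset.range (k * b)).filter P).card = k * ((Finset.range b).filter P).card := by
  rw [← Nat.count_eq_card_filter_range, ← Nat.count_eq_card_filter_range]
  induction k with
  | zero => simp
  | succ k ih =>
    rw [add_mul, one_mul, Nat.count_add, ih, add_mul, one_mul]
    congr 2
    ext x
    rw [add_comm]
    have := hP.nat_mul k x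
    simpa using this.to_iff

lemma rootCount_scale_mul_prime_sq (t q : ℤ) {p : ℕ} (b : ℕ) (hp : p.Prime) :
    rootCount (p * t) (p ^ 2 * q) (p ^ 2 * b) = p * rootCount t q b := by
  have hp0 : (p : ℤ) ≠ 0 := by exact_mod_cast hp.ne_zero
  rw [rootCount, rootCount, ← card_filter_range_mul_of_periodic]
  · symm
    refine Finset.card_bij (fun x _ ↦ p * x) ?_ ?_ ?_
    · intro x hx
      simp only [Finset.mem_filter, Finset.mem_range] at hx ⊢
      refine ⟨by rw [sq, mul_assoc]; exact Nat.mul_lt_mul_of_pos_left hx.1 hp.pos, ?_⟩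
      push_cast
      rw [show ((p : ℤ) * x) ^ 2 - p * t * (p * x) + p ^ 2 * q =
        p ^ 2 * ((x : ℤ) ^ 2 - t * x + q) by ring]
      exact mul_dvd_mul_left _ hx.2
    · intro x _ y _ h
      exact Nat.eq_of_mul_eq_mul_left hp.pos h
    · intro y hy
      simp only [Finset.mem_filter, Finset.mem_range] at hy
      have h1 : (p : ℤ) ∣ (y : ℤ) ^ 2 := by
        have h2 : (p : ℤ) ∣ (y : ℤ) ^ 2 - p * t * y + p ^ 2 * q := by
          refine Dvd.dvd.trans ?_ hy.2
          push_cast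
          exact ⟨p * b, by ring⟩
        have h3 : (p : ℤ) ∣ p * t * y - p ^ 2 * q := ⟨t * y - p * q, by ring⟩
        simpa using dvd_add h2 h3
      have h4 : p ∣ y := by
        have := (Nat.prime_iff_prime_int.mp hp).dvd_of_dvd_pow h1
        exact_mod_cast this
      obtain ⟨x, rfl⟩ := h4
      refine ⟨x, ?_, rfl⟩
      simp only [Finset.mem_filter, Finset.mem_range]
      refine ⟨?_, ?_⟩
      · have := hy.1
        rw [sq, mul_assoc] at this
        exact Nat.lt_of_mul_lt_mul_left this
      · have := hy.2
        push_cast at this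
        rw [show ((p : ℤ) * x) ^ 2 - p * t * (p * x) + p ^ 2 * q =
          p ^ 2 * ((x : ℤ) ^ 2 - t * x + q) by ring] at this
        exact Int.dvd_of_mul_dvd_mul_left (pow_ne_zero 2 hp0) this
  · intro x
    push_cast
    rw [show ((x : ℤ) + b) ^ 2 - t * (x + b) + q =
      ((x : ℤ) ^ 2 - t * x + q) + b * (2 * x + b - t) by ring]
    exact propext (dvd_add_left (Dvd.intro _ rfl))

lemma rootCount_prime_mul_of_dvd (t q : ℤ) {p b : ℕ} (hb : 0 < b) (hp : p.Prime) (hpb : p ∣ b)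
    (hD : ¬ (p : ℤ) ∣ t ^ 2 - 4 * q) :
    rootCount t q (p * b) = rootCount t q b := by
  have hpz := Nat.prime_iff_prime_int.mp hp
  have hpb' : (p : ℤ) ∣ b := by exact_mod_cast hpb
  have hb0 : (b : ℤ) ≠ 0 := by exact_mod_cast hb.ne'
  have hderiv : ∀ x : ℤ, (b : ℤ) ∣ x ^ 2 - t * x + q → ¬ (p : ℤ) ∣ 2 * x - t := by
    intro x hx h
    apply hD
    rw [show t ^ 2 - 4 * q = (2 * x - t) * (2 * x - t) - 4 * (x ^ 2 - t * x + q) by ring]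
    exact dvd_sub (h.mul_right _) ((hpb'.trans hx).mul_left _)
  rw [rootCount, rootCount]
  refine Finset.card_bij (fun x _ ↦ x % b) ?_ ?_ ?_
  · intro x hx
    simp only [Finset.mem_filter, Finset.mem_range] at hx ⊢
    refine ⟨Nat.mod_lt _ hb, ?_⟩
    have h1 : (b : ℤ) ∣ (x : ℤ) ^ 2 - t * x + q := Dvd.dvd.trans ⟨p, by push_cast; ring⟩ hx.2
    have h2 : (x : ℤ) = b * (x / b : ℤ) + (x % b : ℤ) := (Int.mul_ediv_add_emod _ _).symm
    push_cast
    generalize (x % b : ℤ) = r at *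
    generalize (x / b : ℤ) = s at *
    rw [h2, show ((b : ℤ) * s + r) ^ 2 - t * (b * s + r) + q = (r ^ 2 - t * r + q) +
      b * (s * (b * s + 2 * r - t)) by ring] at h1
    exact (dvd_add_left (Dvd.intro _ rfl)).1 h1
  · intro x hx y hy h
    simp only [Finset.mem_filter, Finset.mem_range] at hx hy
    have h1 : (b : ℤ) ∣ (x : ℤ) - y := by
      exact Int.ModEq.dvd ((Int.natCast_modEq_iff).2 h.symm)
    obtain ⟨j, hj⟩ := h1
    have hxb : (b : ℤ) ∣ (x : ℤ) ^ 2 - t * x + q := Dvd.dvd.trans ⟨p, by push_cast; ring⟩ hx.2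
    have h2 : ((p * b : ℕ) : ℤ) ∣ b * (j * (x + y - t)) := by
      have := dvd_sub hx.2 hy.2
      rwa [show ((x : ℤ) ^ 2 - t * x + q) - ((y : ℤ) ^ 2 - t * y + q) =
        (x - y) * (x + y - t) by ring, hj, mul_assoc] at this
    have h3 : (p : ℤ) ∣ j * (x + y - t) := by
      push_cast at h2
      rw [mul_comm (p : ℤ)] at h2
      exact Int.dvd_of_mul_dvd_mul_left hb0 h2
    have h4 : (p : ℤ) ∣ j := by
      refine (hpz.dvd_or_dvd h3).resolve_right fun h5 ↦ hderiv x hxb ?_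
      rw [show 2 * (x : ℤ) - t = (x + y - t) + b * j by rw [← hj]; ring]
      exact dvd_add h5 (hpb'.mul_right _)
    obtain ⟨k, rfl⟩ := h4
    have h6 : (x : ℤ) ≡ y [ZMOD (p * b : ℕ)] := by
      refine (Int.modEq_iff_dvd.2 ⟨k, ?_⟩).symm
      rw [hj]; push_cast; ring
    have h7 := (Int.natCast_modEq_iff).1 h6
    exact Nat.ModEq.eq_of_lt_of_lt h7 hx.1 hy.1
  · intro y hy
    simp only [Finset.mem_filter, Finset.mem_range] at hy
    obtain ⟨c, hc⟩ := hy.2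
    have hcop : IsCoprime (2 * (y : ℤ) - t) (p : ℤ) :=
      (((Prime.coprime_iff_not_dvd hpz).2 (hderiv y hy.2))).symm
    obtain ⟨u, v, huv⟩ := hcop
    have hpb0 : (0 : ℤ) < (p * b : ℕ) := by exact_mod_cast Nat.mul_pos hp.pos hb
    let z : ℤ := y - b * (c * u)
    have hz : ((p * b : ℕ) : ℤ) ∣ z ^ 2 - t * z + q := by
      obtain ⟨d, hd⟩ := hpb'
      refine ⟨c * v + d * (c * u) ^ 2, ?_⟩
      simp only [z]
      have : ((y : ℤ) - b * (c * u)) ^ 2 - t * (y - b * (c * u)) + q =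
        ((y : ℤ) ^ 2 - t * y + q) - b * c * (u * (2 * y - t)) + b * b * (c * u) ^ 2 := by ring
      rw [this, hc, show u * (2 * (y : ℤ) - t) = 1 - v * p by linarith]
      push_cast
      nth_rw 4 [hd]
      ring
    obtain ⟨w, hw⟩ := Int.eq_ofNat_of_zero_le (Int.emod_nonneg z hpb0.ne')
    refine ⟨w, ?_, ?_⟩
    · simp only [Finset.mem_filter, Finset.mem_range]
      refine ⟨?_, ?_⟩
      · have := Int.emod_lt_of_pos z hpb0
        rw [hw] at this
        exact_mod_cast this
      · rw [← hw]
        have h1 : z % (p * b : ℕ) ≡ z [ZMOD (p * b : ℕ)] := Int.mod_modEq _ _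
        have h2 := ((h1.pow 2).sub (h1.mul_left t)).add_right q
        exact (Int.modEq_zero_iff_dvd).1 (h2.trans ((Int.modEq_zero_iff_dvd).2 hz))
    · have : (w : ℤ) % b = y := by
        rw [← hw, Int.emod_emod_of_dvd z (by push_cast; exact Dvd.intro_left _ rfl)]
        simp only [z]
        rw [sub_eq_add_neg, ← mul_neg, Int.add_mul_emod_self_left]
        exact_mod_cast Nat.mod_eq_of_lt hy.1
      exact_mod_cast this

lemma rootCount_eq_zero_of_dvd (t q : ℤ) {d b : ℕ} (h : d ∣ b)
    (hd : ∀ x : ℤ, ¬ (d : ℤ) ∣ x ^ 2 - t * x + q) : rootCount t q b = 0 := by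
  rw [rootCount, Finset.card_eq_zero, Finset.filter_eq_empty_iff]
  intro x _ hx
  exact hd x (Dvd.dvd.trans (by exact_mod_cast h) hx)

lemma rootCount_two (t q : ℤ) :
    rootCount t q 2 = (if 2 ∣ q then 1 else 0) + (if 2 ∣ 1 - t + q then 1 else 0) := by
  rw [rootCount, show Finset.range 2 = {0, 1} from rfl, Finset.filter_insert,
    Finset.filter_singleton]
  simp only [Nat.cast_zero, Nat.cast_one, Nat.cast_ofNat]
  norm_num
  split_ifs <;> simp

lemma rootCount_odd_prime (t q : ℤ) (p : ℕ) [Fact p.Prime] (hp2 : p ≠ 2) :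
    (rootCount t q p : ℤ) = legendreSym p (t ^ 2 - 4 * q) + 1 := by
  rw [← legendreSym.card_sqrts p hp2, rootCount_eq_card_zmod, Nat.card_eq_fintype_card,
    Set.toFinset_card]
  norm_cast
  have h2 : (2 : ZMod p) ≠ 0 := by
    have := Ring.two_ne_zero (R := ZMod p) (by rwa [ZMod.ringChar_zmod_n])
    exact this
  refine Fintype.card_congr (((Equiv.mulLeft₀ (2 : ZMod p) h2).trans
    (Equiv.subRight (t : ZMod p))).subtypeEquiv fun x ↦ ?_)
  simp only [Equiv.trans_apply, Equiv.subRight_apply]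
  push_cast
  have h4 : (4 : ZMod p) ≠ 0 := by
    rw [show (4 : ZMod p) = 2 * 2 by norm_num]; exact mul_ne_zero h2 h2
  change _ ↔ (2 * x - (t : ZMod p)) ^ 2 = _
  rw [← sub_eq_zero (a := (2 * x - (t : ZMod p)) ^ 2),
    show (2 * x - (t : ZMod p)) ^ 2 - (t ^ 2 - 4 * q) = 4 * (x ^ 2 - t * x + q) by ring,
    mul_eq_zero, or_iff_right h4]

lemma IsFundamentalDiscriminant.not_sq_dvd {d : ℤ} (h : IsFundamentalDiscriminant d) {p : ℕ}
    (hp : p.Prime) (hp2 : p ≠ 2) : ¬ (p : ℤ) ^ 2 ∣ d := by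
  have hpz := Nat.prime_iff_prime_int.mp hp
  intro hd
  rcases h with ⟨_, hs⟩ | ⟨m, rfl, _, hs⟩
  · exact hpz.not_isUnit (hs p (by rwa [← sq]))
  · have hc : IsCoprime ((p : ℤ) ^ 2) 4 := by
      have : IsCoprime (p : ℤ) 2 := by
        have := (Nat.coprime_primes hp Nat.prime_two).2 hp2
        exact_mod_cast Nat.isCoprime_iff_coprime.2 this
      rw [show (4 : ℤ) = 2 ^ 2 by norm_num]
      exact this.pow
    exact hpz.not_isUnit (hs p (by rw [← sq]; exact hc.dvd_of_dvd_mul_left hd))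

lemma int_sq_emod_eight_of_odd {x : ℤ} (h : Odd x) : x ^ 2 % 8 = 1 := by
  obtain ⟨y, rfl⟩ := h
  obtain ⟨z, hz⟩ := Int.even_mul_succ_self y
  rw [show (2 * y + 1) ^ 2 = 4 * (y * (y + 1)) + 1 by ring, hz]
  omega

lemma rootCount_prime_trichotomy {d₀ t q : ℤ} {k p : ℕ} (hd : IsFundamentalDiscriminant d₀)
    (hD : t ^ 2 - 4 * q = (k : ℤ) ^ 2 * d₀) (hp : p.Prime) (hk : ¬ p ∣ k) :
    (¬ (p : ℤ) ∣ t ^ 2 - 4 * q ∧ kroneckerChi d₀ p = 1 ∧ rootCount t q p = 2) ∨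
    (¬ (p : ℤ) ∣ t ^ 2 - 4 * q ∧ kroneckerChi d₀ p = -1 ∧ rootCount t q p = 0) ∨
    (kroneckerChi d₀ p = 0 ∧ rootCount t q p = 1 ∧
      ∀ x : ℤ, ¬ ((p ^ 2 : ℕ) : ℤ) ∣ x ^ 2 - t * x + q) := by
  have hpz := Nat.prime_iff_prime_int.mp hp
  have hkz : ¬ (p : ℤ) ∣ k := by exact_mod_cast hk
  have hdvd : (p : ℤ) ∣ t ^ 2 - 4 * q ↔ (p : ℤ) ∣ d₀ := by
    rw [hD]
    exact ⟨fun h ↦ (hpz.dvd_or_dvd h).resolve_left fun h ↦ hkz (hpz.dvd_of_dvd_pow h),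
      fun h ↦ h.mul_left _⟩
  rcases eq_or_ne p 2 with rfl | hp2
  · have hko : (k : ℤ) ^ 2 % 8 = 1 := by
      have : (k : ℤ) % 2 = 1 := by omega
      exact int_sq_emod_eight_of_odd (Int.odd_iff.2 this)
    have hDm : (t ^ 2 - 4 * q) % 8 = d₀ % 8 := by
      rw [hD, Int.mul_emod, hko, one_mul, Int.emod_emod_of_dvd _ dvd_rfl]
    have ht8 : t % 2 = 1 → t ^ 2 % 8 = 1 := fun h ↦
      int_sq_emod_eight_of_odd (Int.odd_iff.2 h)
    have ht4 : t % 2 = 0 → t ^ 2 % 4 = 0 := by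
      intro h
      obtain ⟨s, rfl⟩ := Int.dvd_of_emod_eq_zero h
      rw [show (2 * s) ^ 2 = 4 * s ^ 2 by ring]; omega
    rw [hdvd, rootCount_two, kroneckerChi, if_pos rfl]
    push_cast
    rcases hd with ⟨h1, _⟩ | ⟨m, rfl, hm, _⟩
    · have ht : t % 2 = 1 := by
        by_contra h
        have := ht4 (by omega)
        omega
      have := ht8 ht
      rcases (by omega : d₀ % 8 = 1 ∨ d₀ % 8 = 5) with h8 | h8
      · left
        refine ⟨by omega, by simp [h8], ?_⟩
        rw [if_pos (by omega), if_pos (by omega)]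
      · right; left
        refine ⟨by omega, by simp [h8], ?_⟩
        rw [if_neg (by omega), if_neg (by omega)]
    · right; right
      have ht : t % 2 = 0 := by
        by_contra h
        have := ht8 (by omega)
        omega
      refine ⟨?_, ?_, ?_⟩
      · rw [if_neg (by omega), if_neg (by omega)]
      · by_cases hq : 2 ∣ q
        · rw [if_pos hq, if_neg (by omega)]
        · rw [if_neg hq, if_pos (by omega)]
      · rintro x ⟨y, hy⟩
        obtain ⟨s, rfl⟩ := Int.dvd_of_emod_eq_zero ht
        obtain ⟨l, hl⟩ : ∃ l, (k : ℤ) ^ 2 = 4 * l + 1 := ⟨(k : ℤ) ^ 2 / 4, by omega⟩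
        have h1 : (x - s) ^ 2 = 4 * (y + l * m) + m := by
          rw [hl] at hD
          linarith
        rcases Int.even_or_odd (x - s) with h | h
        · obtain ⟨r, hr⟩ := h
          rw [hr, show (r + r) ^ 2 = 4 * r ^ 2 by ring] at h1
          omega
        · have := Int.sq_mod_four_eq_one_of_odd h
          omega
  · have := Fact.mk hp
    have hR := rootCount_odd_prime t q p hp2
    have hleg : legendreSym p (t ^ 2 - 4 * q) = legendreSym p d₀ := by
      rw [hD, legendreSym.mul, pow_two, legendreSym.mul, ← pow_two, legendreSym.sq_one, one_mul]
      rwa [Ne, ZMod.intCast_zmod_eq_zero_iff_dvd]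
    rw [hleg] at hR
    rw [hdvd, kroneckerChi, if_neg hp2]
    by_cases h0 : (p : ℤ) ∣ d₀
    · right; right
      refine ⟨if_pos h0, ?_, ?_⟩
      · rw [(legendreSym.eq_zero_iff p d₀).2 ((ZMod.intCast_zmod_eq_zero_iff_dvd _ _).2 h0)] at hR
        exact_mod_cast hR
      · intro x hx
        push_cast at hx
        have h1 : (p : ℤ) ∣ 2 * x - t := by
          refine hpz.dvd_of_dvd_pow (n := 2) ?_
          rw [show (2 * x - t) ^ 2 = 4 * (x ^ 2 - t * x + q) + (t ^ 2 - 4 * q) by ring]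
          exact dvd_add (((dvd_pow_self (p : ℤ) two_ne_zero).trans hx).mul_left _) (hdvd.2 h0)
        have h2 : (p : ℤ) ^ 2 ∣ (k : ℤ) ^ 2 * d₀ := by
          rw [← hD, show t ^ 2 - 4 * q = (2 * x - t) ^ 2 - 4 * (x ^ 2 - t * x + q) by ring]
          exact dvd_sub (pow_dvd_pow_of_dvd h1 2) (hx.mul_left _)
        have h3 : IsCoprime ((p : ℤ) ^ 2) ((k : ℤ) ^ 2) :=
          ((Prime.coprime_iff_not_dvd hpz).2 hkz).pow
        exact hd.not_sq_dvd hp hp2 (h3.dvd_of_dvd_mul_left h2)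
    · rw [if_neg h0]
      have h0' : (d₀ : ZMod p) ≠ 0 := by rwa [Ne, ZMod.intCast_zmod_eq_zero_iff_dvd]
      by_cases hsq : IsSquare (d₀ : ZMod p)
      · left
        rw [(legendreSym.eq_one_iff p h0').2 hsq] at hR
        exact ⟨h0, if_pos hsq, by exact_mod_cast hR⟩
      · right; left
        rw [(legendreSym.eq_neg_one_iff p).2 hsq] at hR
        exact ⟨h0, if_neg hsq, by omega⟩

lemma rootCount_prime_mul {d₀ t q : ℤ} {k p b : ℕ} (hd : IsFundamentalDiscriminant d₀)
    (hD : t ^ 2 - 4 * q = (k : ℤ) ^ 2 * d₀) (hp : p.Prime) (hk : ¬ p ∣ k) (hb : 0 < b) :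
    (rootCount t q (p * b) : ℤ) =
      kroneckerChi d₀ p * rootCount t q b + if p ∣ b then 0 else (rootCount t q b : ℤ) := by
  have : NeZero p := ⟨hp.ne_zero⟩
  have : NeZero b := ⟨hb.ne'⟩
  have htri := rootCount_prime_trichotomy hd hD hp hk
  by_cases hpb : p ∣ b
  · rw [if_pos hpb, add_zero]
    rcases htri with ⟨h1, h2, _⟩ | ⟨_, h2, h3⟩ | ⟨h2, h3, h4⟩
    · rw [h2, rootCount_prime_mul_of_dvd t q hb hp hpb h1, one_mul]
    · have hno : ∀ x : ℤ, ¬ (p : ℤ) ∣ x ^ 2 - t * x + q := by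
        intro x hx
        rw [rootCount_eq_card_zmod, Nat.card_eq_zero] at h3
        rcases h3 with h3 | h3
        · refine h3.false ⟨(x : ZMod p), ?_⟩
          rw [← ZMod.intCast_zmod_eq_zero_iff_dvd] at hx
          exact_mod_cast hx
        · exact not_finite_iff_infinite.2 h3 inferInstance
      rw [rootCount_eq_zero_of_dvd t q (hpb.mul_left p) hno, rootCount_eq_zero_of_dvd t q hpb hno]
      simp
    · rw [h2, rootCount_eq_zero_of_dvd t q (by rw [sq]; exact mul_dvd_mul_left p hpb) h4]
      simp
  · rw [if_neg hpb, rootCount_mul t q ((Nat.Prime.coprime_iff_not_dvd hp).2 hpb)]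
    rcases htri with ⟨_, h2, h3⟩ | ⟨_, h2, h3⟩ | ⟨h2, h3, _⟩ <;> rw [h2, h3] <;> push_cast <;> ring

lemma rootCount_scale_pow_succ {d₀ t q : ℤ} {k p : ℕ} (hd : IsFundamentalDiscriminant d₀)
    (hD : t ^ 2 - 4 * q = (k : ℤ) ^ 2 * d₀) (hp : p.Prime) (hk : ¬ p ∣ k) (e : ℕ) {a : ℕ}
    (ha : 0 < a) :
    (rootCount ((p ^ (e + 1) : ℕ) * t) ((p ^ (e + 1) : ℕ) ^ 2 * q) a : ℤ) =
      rootCount t q a - kroneckerChi d₀ p * (if p ∣ a then (rootCount t q (a / p) : ℤ) else 0) +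
        p * (if p ^ 2 ∣ a then
          (rootCount ((p ^ e : ℕ) * t) ((p ^ e : ℕ) ^ 2 * q) (a / p ^ 2) : ℤ) else 0) := by
  have hstep : ∀ a, rootCount ((p ^ (e + 1) : ℕ) * t) ((p ^ (e + 1) : ℕ) ^ 2 * q) a =
      rootCount (p * ((p ^ e : ℕ) * t)) (p ^ 2 * ((p ^ e : ℕ) ^ 2 * q)) a := by
    intro a
    congr 1 <;> push_cast <;> ring
  by_cases h1 : p ∣ a
  · obtain ⟨b, rfl⟩ := h1
    have hb : 0 < b := Nat.pos_of_mul_pos_left ha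
    have : NeZero b := ⟨hb.ne'⟩
    rw [if_pos (Dvd.intro _ rfl), Nat.mul_div_cancel_left _ hp.pos, hstep,
      rootCount_prime_mul hd hD hp hk hb]
    by_cases h2 : p ∣ b
    · obtain ⟨c, rfl⟩ := h2
      have hc : p ^ 2 * c = p * (p * c) := by ring
      rw [if_pos (Dvd.intro _ rfl), if_pos ⟨c, hc.symm⟩, ← hc,
        Nat.mul_div_cancel_left _ (pow_pos hp.pos 2), rootCount_scale_mul_prime_sq _ _ _ hp]
      push_cast
      ring
    · rw [if_neg h2, if_neg, rootCount_scale_mul_prime _ _ hp h2, rootCount_scale_of_coprime]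
      · ring
      · exact ((Nat.Prime.coprime_iff_not_dvd hp).2 h2).pow_left e
      · rw [sq]; exact fun h ↦ h2 (Nat.dvd_of_mul_dvd_mul_left hp.pos h)
  · have : NeZero a := ⟨ha.ne'⟩
    rw [if_neg h1, if_neg fun h ↦ h1 ((dvd_pow_self p two_ne_zero).trans h),
      rootCount_scale_of_coprime]
    · ring
    · exact ((Nat.Prime.coprime_iff_not_dvd hp).2 h1).pow_left _

/-- The arithmetic function `F` has mean value `c`. -/
def HasMean (F : ℕ → ℝ) (c : ℝ) : Prop :=
  Tendsto (fun T : ℝ ↦ (∑ a ∈ Finset.Icc 1 ⌊T⌋₊, F a) / T) atTop (nhds c)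

lemma HasMean.congr {F G : ℕ → ℝ} {c : ℝ} (hF : HasMean F c) (h : ∀ a, 0 < a → F a = G a) :
    HasMean G c := by
  refine Tendsto.congr (fun T ↦ ?_) hF
  rw [Finset.sum_congr rfl fun a ha ↦ h a (Finset.mem_Icc.1 ha).1]

lemma HasMean.add {F G : ℕ → ℝ} {c d : ℝ} (hF : HasMean F c) (hG : HasMean G d) :
    HasMean (fun a ↦ F a + G a) (c + d) := by
  refine Tendsto.congr (fun T ↦ ?_) (Tendsto.add hF hG)
  rw [Finset.sum_add_distrib, add_div]

lemma HasMean.const_mul {F : ℕ → ℝ} {c : ℝ} (r : ℝ) (hF : HasMean F c) :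
    HasMean (fun a ↦ r * F a) (r * c) := by
  refine Tendsto.congr (fun T ↦ ?_) (Tendsto.const_mul r hF)
  rw [← Finset.mul_sum, mul_div_assoc]

lemma HasMean.comp_div {F : ℕ → ℝ} {c : ℝ} (hF : HasMean F c) {k : ℕ} (hk : 0 < k) :
    HasMean (fun a ↦ if k ∣ a then F (a / k) else 0) (c / k) := by
  have hk' : (0 : ℝ) < k := by exact_mod_cast hk
  have h := (hF.comp (tendsto_id.atTop_div_const hk')).div_const (k : ℝ)
  refine Tendsto.congr (fun T ↦ ?_) h
  simp only [Function.comp_apply, id]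
  rw [← Finset.sum_filter]
  have : ∑ a ∈ (Finset.Icc 1 ⌊T⌋₊).filter (k ∣ ·), F (a / k) =
      ∑ a ∈ Finset.Icc 1 ⌊T / k⌋₊, F a := by
    symm
    refine Finset.sum_bij (fun a _ ↦ k * a) ?_ ?_ ?_ ?_
    · intro a ha
      rw [Finset.mem_Icc, Nat.floor_div_natCast, Nat.le_div_iff_mul_le hk] at ha
      rw [Finset.mem_filter, Finset.mem_Icc]
      exact ⟨⟨Nat.mul_pos hk ha.1, by rw [mul_comm]; exact ha.2⟩, Dvd.intro _ rfl⟩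
    · intro a _ b _ h
      exact Nat.eq_of_mul_eq_mul_left hk h
    · intro b hb
      rw [Finset.mem_filter, Finset.mem_Icc] at hb
      obtain ⟨⟨h1, h2⟩, a, rfl⟩ := hb
      refine ⟨a, ?_, rfl⟩
      rw [Finset.mem_Icc, Nat.floor_div_natCast, Nat.le_div_iff_mul_le hk]
      exact ⟨Nat.pos_of_mul_pos_left h1, by rw [mul_comm]; exact h2⟩
    · intro a _
      rw [Nat.mul_div_cancel_left _ hk]
  rw [this]
  field_simp

lemma sigmaOne_prime_pow_succ {p : ℕ} (hp : p.Prime) (e : ℕ) :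
    sigmaOne (p ^ (e + 1)) = p ^ (e + 1) + sigmaOne (p ^ e) := by
  rw [sigmaOne, sigmaOne, Nat.sum_divisors_prime_pow hp, Nat.sum_divisors_prime_pow hp,
    Finset.sum_range_succ, add_comm]

lemma HasMean.scale_pow {d₀ t q : ℤ} {k p : ℕ} (hd : IsFundamentalDiscriminant d₀)
    (hD : t ^ 2 - 4 * q = (k : ℤ) ^ 2 * d₀) (hp : p.Prime) (hk : ¬ p ∣ k) {c : ℝ}
    (hc : HasMean (fun a ↦ rootCount t q a) c) (e : ℕ) :
    HasMean (fun a ↦ rootCount ((p ^ (e + 1) : ℕ) * t) ((p ^ (e + 1) : ℕ) ^ 2 * q) a)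
      (c * (((sigmaOne (p ^ (e + 1)) : ℝ) - kroneckerChi d₀ p * sigmaOne (p ^ e)) /
        (p : ℝ) ^ (e + 1))) := by
  have hp0 : (p : ℝ) ≠ 0 := by exact_mod_cast hp.ne_zero
  have key : ∀ e : ℕ, ∀ m : ℝ,
      HasMean (fun a ↦ rootCount ((p ^ e : ℕ) * t) ((p ^ e : ℕ) ^ 2 * q) a) m →
      HasMean (fun a ↦ rootCount ((p ^ (e + 1) : ℕ) * t) ((p ^ (e + 1) : ℕ) ^ 2 * q) a)
        (c + -kroneckerChi d₀ p * (c / p) + p * (m / (p ^ 2 : ℕ))) := by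
    intro e m hm
    refine HasMean.congr ((hc.add ((hc.comp_div hp.pos).const_mul (-kroneckerChi d₀ p))).add
      ((hm.comp_div (pow_pos hp.pos 2)).const_mul p)) fun a ha ↦ ?_
    have := rootCount_scale_pow_succ hd hD hp hk e ha
    have := congrArg (Int.cast : ℤ → ℝ) this
    push_cast at this ⊢
    rw [this]
    ring
  induction e with
  | zero =>
    have h0 := key 0 c (by simpa using hc)
    convert h0 using 1
    rw [sigmaOne_prime_pow_succ hp 0]
    simp only [pow_zero, zero_add, sigmaOne, Nat.divisors_one, Finset.sum_singleton]
    push_cast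
    field_simp
    ring
  | succ e ih =>
    have h1 := key (e + 1) _ ih
    convert h1 using 1
    rw [sigmaOne_prime_pow_succ hp (e + 1), sigmaOne_prime_pow_succ hp e]
    push_cast
    field_simp
    ring

theorem hasMean_rootCount_scale {d₀ t q : ℤ} (hd : IsFundamentalDiscriminant d₀)
    (hD : t ^ 2 - 4 * q = d₀) {c : ℝ} (hc : HasMean (fun a ↦ rootCount t q a) c)
    {f : ℕ} (hf : 0 < f) :
    HasMean (fun a ↦ rootCount (f * t) (f ^ 2 * q) a)
      (c * ((∏ p ∈ f.primeFactors, ((sigmaOne (p ^ (f.factorization p)) : ℝ) -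
        (kroneckerChi d₀ p : ℝ) * (sigmaOne (p ^ (f.factorization p - 1)) : ℝ))) / f)) := by
  induction f using Nat.recOnPrimePow with
  | zero => exact absurd hf (lt_irrefl 0)
  | one => simpa using hc
  | prime_pow_mul f p e hp hpf he ih =>
    have hf0 : 0 < f := Nat.pos_of_mul_pos_left hf
    obtain ⟨e, rfl⟩ : ∃ e', e = e' + 1 := Nat.exists_eq_succ_of_ne_zero he.ne'
    have hcop : (p ^ (e + 1)).Coprime f := ((Nat.Prime.coprime_iff_not_dvd hp).2 hpf).pow_left _
    have h := HasMean.scale_pow (k := f) hd (by rw [← hD]; ring) hp hpf (ih hf0) e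
    convert h using 1
    · ext a
      congr 2 <;> push_cast <;> ring
    · rw [hcop.primeFactors_mul, Finset.prod_union hcop.disjoint_primeFactors,
        Nat.primeFactors_prime_pow (Nat.succ_ne_zero e) hp, Finset.prod_singleton]
      have hfp : (p ^ (e + 1) * f).factorization p = e + 1 := by
        rw [Nat.factorization_mul (pow_ne_zero _ hp.ne_zero) hf0.ne', Finsupp.add_apply,
          Nat.factorization_eq_zero_of_not_dvd hpf, hp.factorization_pow]
        simp
      have hff : ∀ r ∈ f.primeFactors, (p ^ (e + 1) * f).factorization r = f.factorization r := by
        intro r hr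
        have hrp : r ≠ p := by
          rintro rfl
          exact hpf (Nat.dvd_of_mem_primeFactors hr)
        rw [Nat.factorization_mul (pow_ne_zero _ hp.ne_zero) hf0.ne', Finsupp.add_apply,
          hp.factorization_pow]
        simp [hrp.symm]
      rw [hfp, Finset.prod_congr rfl fun r hr ↦ by rw [hff r hr]]
      simp only [Nat.add_sub_cancel]
      push_cast
      have hp0 : (p : ℝ) ≠ 0 := by exact_mod_cast hp.ne_zero
      have hf0' : (f : ℝ) ≠ 0 := by exact_mod_cast hf0.ne'
      field_simp

/-- `b` is a `ℤ`-basis `1, ω` of the ring `R` such that `ω ^ 2 - t * ω + q = 0`. -/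
structure IsQuadraticBasis {R : Type*} [CommRing R] (b : Module.Basis (Fin 2) ℤ R) (t q : ℤ) :
    Prop where
  zero : b 0 = 1
  one_sq : b 1 ^ 2 = t * b 1 - q

namespace IsQuadraticBasis

variable {R : Type*} [CommRing R] {b : Module.Basis (Fin 2) ℤ R} {t q : ℤ}

lemma eq_coord (h : IsQuadraticBasis b t q) (z : R) :
    z = b.coord 0 z + b.coord 1 z * b 1 := by
  have := b.sum_repr z
  rw [Fin.sum_univ_two, h.zero] at this
  simpa [zsmul_eq_mul] using this.symm

lemma coord_zero (h : IsQuadraticBasis b t q) (x y : ℤ) : b.coord 0 (x + y * b 1) = x := by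
  have : (x : R) + y * b 1 = x • b 0 + y • b 1 := by simp [h.zero, zsmul_eq_mul]
  rw [this, map_add, map_smul, map_smul, Module.Basis.coord_apply, Module.Basis.coord_apply,
    b.repr_self, b.repr_self]
  simp

lemma coord_one (h : IsQuadraticBasis b t q) (x y : ℤ) : b.coord 1 (x + y * b 1) = y := by
  have : (x : R) + y * b 1 = x • b 0 + y • b 1 := by simp [h.zero, zsmul_eq_mul]
  rw [this, map_add, map_smul, map_smul, Module.Basis.coord_apply, Module.Basis.coord_apply,
    b.repr_self, b.repr_self]
  simp

lemma mul_eq (h : IsQuadraticBasis b t q) (z w : R) :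
    z * w = (b.coord 0 z * b.coord 0 w - q * (b.coord 1 z * b.coord 1 w) : ℤ) +
      (b.coord 0 z * b.coord 1 w + b.coord 1 z * b.coord 0 w +
        t * (b.coord 1 z * b.coord 1 w) : ℤ) * b 1 := by
  nth_rw 1 [h.eq_coord z, h.eq_coord w]
  push_cast
  linear_combination (b.coord 1 z * b.coord 1 w : R) * h.one_sq

lemma coord_zero_mul (h : IsQuadraticBasis b t q) (z w : R) :
    b.coord 0 (z * w) = b.coord 0 z * b.coord 0 w - q * (b.coord 1 z * b.coord 1 w) := by
  rw [h.mul_eq, h.coord_zero]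

lemma coord_one_mul (h : IsQuadraticBasis b t q) (z w : R) :
    b.coord 1 (z * w) = b.coord 0 z * b.coord 1 w + b.coord 1 z * b.coord 0 w +
        t * (b.coord 1 z * b.coord 1 w) := by
  rw [h.mul_eq, h.coord_one]

lemma coord_zero_intCast (h : IsQuadraticBasis b t q) (x : ℤ) : b.coord 0 (x : R) = x := by
  simpa using h.coord_zero x 0

lemma coord_one_intCast (h : IsQuadraticBasis b t q) (x : ℤ) : b.coord 1 (x : R) = 0 := by
  simpa using h.coord_one x 0

lemma coord_zero_one (_h : IsQuadraticBasis b t q) : b.coord 0 (b 1) = 0 := by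
  simp

lemma coord_one_one (_h : IsQuadraticBasis b t q) : b.coord 1 (b 1) = 1 := by
  simp

lemma intCast_dvd_iff (h : IsQuadraticBasis b t q) (m : ℤ) (z : R) :
    (m : R) ∣ z ↔ m ∣ b.coord 0 z ∧ m ∣ b.coord 1 z := by
  constructor
  · rintro ⟨w, rfl⟩
    rw [h.coord_zero_mul, h.coord_one_mul, h.coord_zero_intCast, h.coord_one_intCast]
    exact ⟨⟨b.coord 0 w, by ring⟩, ⟨b.coord 1 w, by ring⟩⟩
  · rintro ⟨⟨x, hx⟩, ⟨y, hy⟩⟩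
    refine ⟨x + y * b 1, ?_⟩
    rw [h.eq_coord z, hx, hy]
    push_cast
    ring

/-- Evaluation at a root `s` of `x ^ 2 - t * x + q` modulo `c`. -/
noncomputable def evalHom (h : IsQuadraticBasis b t q) {c : ℕ} {s : ℤ} (hs : (c : ℤ) ∣ s ^ 2 - t * s + q) :
    R →+* ZMod c where
  toFun z := (b.coord 0 z + s * b.coord 1 z : ℤ)
  map_one' := by
    have h0 := h.coord_zero_intCast 1
    have h1 := h.coord_one_intCast 1
    rw [Int.cast_one] at h0 h1
    rw [h0, h1]; simp
  map_zero' := by simp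
  map_add' z w := by simp only [map_add]; push_cast; ring
  map_mul' z w := by
    rw [h.coord_zero_mul, h.coord_one_mul]
    rw [← ZMod.intCast_zmod_eq_zero_iff_dvd] at hs
    push_cast at hs ⊢
    linear_combination -(b.coord 1 z * b.coord 1 w : ZMod c) * hs

lemma evalHom_apply (h : IsQuadraticBasis b t q) {c : ℕ} {s : ℤ}
    (hs : (c : ℤ) ∣ s ^ 2 - t * s + q) (z : R) :
    h.evalHom hs z = (b.coord 0 z + s * b.coord 1 z : ℤ) := rfl

lemma evalHom_surjective (h : IsQuadraticBasis b t q) {c : ℕ} {s : ℤ}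
    (hs : (c : ℤ) ∣ s ^ 2 - t * s + q) : Function.Surjective (h.evalHom hs) :=
  ZMod.ringHom_surjective _

lemma mem_span_iff (h : IsQuadraticBasis b t q) {c : ℕ} {s : ℤ}
    (hs : (c : ℤ) ∣ s ^ 2 - t * s + q) (z : R) :
    z ∈ Ideal.span {(c : R), b 1 - s} ↔ (c : ℤ) ∣ b.coord 0 z + s * b.coord 1 z := by
  constructor
  · intro hz
    rw [← ZMod.intCast_zmod_eq_zero_iff_dvd, ← h.evalHom_apply hs, ← RingHom.mem_ker]
    refine (Ideal.span_le.2 ?_) hz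
    rintro w (rfl | rfl)
    · simp [RingHom.mem_ker]
    · rw [SetLike.mem_coe, RingHom.mem_ker, map_sub, map_intCast, h.evalHom_apply,
        h.coord_zero_one, h.coord_one_one]
      simp
  · rintro ⟨d, hd⟩
    rw [Ideal.mem_span_pair]
    refine ⟨d, b.coord 1 z, ?_⟩
    nth_rw 2 [h.eq_coord z]
    have := congrArg (Int.cast : ℤ → R) hd
    push_cast at this
    linear_combination -this

lemma span_eq_ker (h : IsQuadraticBasis b t q) {c : ℕ} {s : ℤ}
    (hs : (c : ℤ) ∣ s ^ 2 - t * s + q) :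
    Ideal.span {(c : R), b 1 - s} = RingHom.ker (h.evalHom hs) := by
  ext z
  rw [h.mem_span_iff hs, RingHom.mem_ker, h.evalHom_apply, ZMod.intCast_zmod_eq_zero_iff_dvd]

/-- An ideal is primitive if no integer other than `± 1` divides all its elements. -/
def _root_.Ideal.IsPrimitive {R : Type*} [CommRing R] (J : Ideal R) : Prop :=
  ∀ m : ℕ, J ≤ Ideal.span {(m : R)} → m = 1

lemma isPrimitive_span (h : IsQuadraticBasis b t q) {c : ℕ} {s : ℤ} :
    (Ideal.span {(c : R), b 1 - s}).IsPrimitive := by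
  intro m hm
  have h1 : b 1 - s ∈ Ideal.span {(m : R)} := hm (Ideal.subset_span (by simp))
  rw [Ideal.mem_span_singleton] at h1
  have h2 := ((h.intCast_dvd_iff m (b 1 - s)).1 (by exact_mod_cast h1)).2
  rw [map_sub, h.coord_one_one, h.coord_one_intCast, sub_zero] at h2
  have : m ∣ 1 := by exact_mod_cast h2
  exact Nat.dvd_one.1 this

lemma exists_sub_mem_of_isPrimitive (h : IsQuadraticBasis b t q) {J : Ideal R}
    (hJ : J.IsPrimitive) : ∃ s : ℤ, b 1 - s ∈ J := by
  let C : Submodule ℤ ℤ := (J.restrictScalars ℤ).map (b.coord 1)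
  obtain ⟨k, hk⟩ := (IsPrincipalIdealRing.principal (C : Ideal ℤ)).principal
  have hmem : ∀ z ∈ J, k ∣ b.coord 1 z := by
    intro z hz
    have : b.coord 1 z ∈ C := ⟨z, hz, rfl⟩
    rw [hk] at this
    exact Ideal.mem_span_singleton.1 this
  have hdvd : J ≤ Ideal.span {((k.natAbs : ℕ) : R)} := by
    intro z hz
    have h1 := hmem z hz
    have h2 := hmem _ (J.mul_mem_left (b 1) hz)
    rw [h.coord_one_mul, h.coord_zero_one, h.coord_one_one, zero_mul, zero_add, one_mul,
      one_mul] at h2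
    have h3 : k ∣ b.coord 0 z := (dvd_add_left (h1.mul_left t)).1 h2
    rw [Ideal.mem_span_singleton]
    have := (h.intCast_dvd_iff (k.natAbs : ℤ) z).2 ⟨Int.natAbs_dvd.2 h3, Int.natAbs_dvd.2 h1⟩
    rwa [Int.cast_natCast] at this
  have hk1 := hJ _ hdvd
  have h1C : (1 : ℤ) ∈ C := by
    rw [hk]
    exact Ideal.mem_span_singleton.2 (Int.natAbs_dvd.1 (by rw [hk1]; simp))
  obtain ⟨z, hz, hz1⟩ := h1C
  refine ⟨-b.coord 0 z, ?_⟩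
  have h4 := h.eq_coord z
  rw [hz1] at h4
  have : b 1 - ((-b.coord 0 z : ℤ) : R) = z := by
    push_cast at h4 ⊢
    linear_combination -h4
  rw [this]
  exact hz

lemma exists_eq_span_of_isPrimitive (h : IsQuadraticBasis b t q) {J : Ideal R}
    (hJ : J.IsPrimitive) :
    ∃ (c : ℕ) (s : ℤ), (c : ℤ) ∣ s ^ 2 - t * s + q ∧ J = Ideal.span {(c : R), b 1 - s} := by
  obtain ⟨s, hs⟩ := h.exists_sub_mem_of_isPrimitive hJ
  obtain ⟨k, hk⟩ :=
    (IsPrincipalIdealRing.principal (J.comap (Int.castRingHom R))).principal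
  have hmem : ∀ n : ℤ, (n : R) ∈ J ↔ k ∣ n := by
    intro n
    rw [← Ideal.mem_span_singleton, ← Ideal.submodule_span_eq, ← hk]
    rfl
  have hroot : ((k.natAbs : ℕ) : ℤ) ∣ s ^ 2 - t * s + q := by
    rw [Int.natAbs_dvd, ← hmem]
    have : ((s ^ 2 - t * s + q : ℤ) : R) = (-(b 1 + s - t)) * (b 1 - s) := by
      push_cast
      linear_combination h.one_sq
    rw [this]
    exact J.mul_mem_left _ hs
  refine ⟨k.natAbs, s, hroot, ?_⟩
  ext z
  rw [h.mem_span_iff hroot, Int.natAbs_dvd, ← hmem]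
  have : ((b.coord 0 z + s * b.coord 1 z : ℤ) : R) = z - b.coord 1 z * (b 1 - s) := by
    nth_rw 3 [h.eq_coord z]
    push_cast
    ring
  rw [this]
  exact ⟨fun hz ↦ J.sub_mem hz (J.mul_mem_left _ hs), fun hz ↦
    by simpa using J.add_mem hz (J.mul_mem_left (b.coord 1 z : R) hs)⟩

variable [IsDedekindDomain R] [Module.Free ℤ R]

lemma absNorm_span (h : IsQuadraticBasis b t q) {c : ℕ} {s : ℤ}
    (hs : (c : ℤ) ∣ s ^ 2 - t * s + q) :
    Ideal.absNorm (Ideal.span {(c : R), b 1 - s}) = c := by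
  rw [h.span_eq_ker hs, Ideal.absNorm_apply, Submodule.cardQuot_apply,
    Nat.card_congr (RingHom.quotientKerEquivOfSurjective (h.evalHom_surjective hs)).toEquiv,
    Nat.card_zmod]

lemma ncard_isPrimitive_absNorm_eq (h : IsQuadraticBasis b t q) {a : ℕ} (ha : 0 < a) :
    {J : Ideal R | J.IsPrimitive ∧ Ideal.absNorm J = a}.ncard = rootCount t q a := by
  rw [rootCount, ← Set.ncard_coe_finset]
  symm
  refine Set.ncard_congr (fun s _ ↦ Ideal.span {(a : R), b 1 - ((s : ℤ) : R)}) ?_ ?_ ?_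
  · intro s hs
    simp only [Finset.coe_filter, Finset.mem_range, Set.mem_ofPred_eq] at hs
    exact ⟨h.isPrimitive_span, h.absNorm_span hs.2⟩
  · intro s r hs hr hsr
    simp only [Finset.coe_filter, Finset.mem_range, Set.mem_ofPred_eq] at hs hr
    have h1 : b 1 - ((s : ℤ) : R) ∈ Ideal.span {(a : R), b 1 - ((r : ℤ) : R)} := by
      rw [← hsr]
      exact Ideal.subset_span (by simp)
    rw [h.mem_span_iff hr.2, map_sub, map_sub, h.coord_zero_one, h.coord_one_one,
      h.coord_zero_intCast, h.coord_one_intCast] at h1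
    have h2 : (s : ℤ) ≡ r [ZMOD a] := (Int.modEq_iff_dvd).2 (by
      convert h1 using 1; ring)
    exact Nat.ModEq.eq_of_lt_of_lt (Int.natCast_modEq_iff.1 h2) hs.1 hr.1
  · rintro J ⟨hJ, hJa⟩
    obtain ⟨c, s, hs, rfl⟩ := h.exists_eq_span_of_isPrimitive hJ
    rw [h.absNorm_span hs] at hJa
    subst hJa
    obtain ⟨r, hr⟩ := Int.eq_ofNat_of_zero_le
      (Int.emod_nonneg s (by exact_mod_cast ha.ne' : (c : ℤ) ≠ 0))
    have hsr : s ≡ r [ZMOD c] := by rw [← hr]; exact (Int.mod_modEq _ _).symm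
    have hr2 : (c : ℤ) ∣ (r : ℤ) ^ 2 - t * r + q :=
      Int.modEq_zero_iff_dvd.1 (((((hsr.pow 2).sub (hsr.mul_left t)).add_right q).symm).trans
        (Int.modEq_zero_iff_dvd.2 hs))
    refine ⟨r, ?_, ?_⟩
    · simp only [Finset.coe_filter, Finset.mem_range, Set.mem_ofPred_eq]
      refine ⟨?_, hr2⟩
      have := Int.emod_lt_of_pos s (by exact_mod_cast ha : (0 : ℤ) < c)
      rw [hr] at this
      exact_mod_cast this
    · ext z
      rw [h.mem_span_iff hr2, h.mem_span_iff hs, ← Int.modEq_zero_iff_dvd,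
        ← Int.modEq_zero_iff_dvd]
      have := (hsr.mul_right (b.coord 1 z)).add_left (b.coord 0 z)
      exact ⟨fun h ↦ this.trans h, fun h ↦ this.symm.trans h⟩

end IsQuadraticBasis

open ArithmeticFunction in
lemma hasSum_moebius_div_sq :
    HasSum (fun m : ℕ ↦ (moebius m : ℝ) / (m : ℝ) ^ 2) (6 / π ^ 2) := by
  have h2 : (1 : ℝ) < (2 : ℂ).re := by norm_num
  have hsum := (LSeriesSummable_moebius_iff.2 h2).LSeriesHasSum
  have hval : LSeries (fun n ↦ ((moebius n : ℤ) : ℂ)) 2 = ((6 / π ^ 2 : ℝ) : ℂ) := by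
    have h := LSeries_zeta_mul_Lseries_moebius h2
    rw [LSeries_zeta_eq_riemannZeta h2, riemannZeta_two] at h
    have hpi : (π : ℂ) ≠ 0 := by exact_mod_cast pi_ne_zero
    push_cast
    field_simp at h ⊢
    linear_combination h
  rw [hval, LSeriesHasSum] at hsum
  rw [← Complex.hasSum_ofReal]
  convert hsum using 2 with m
  rcases eq_or_ne m 0 with rfl | hm
  · simp
  · rw [LSeries.term_of_ne_zero hm]
    norm_cast

open ArithmeticFunction in
lemma sum_divisors_moebius (c : ℕ) :
    ∑ m ∈ c.divisors, moebius m = if c = 1 then 1 else 0 := by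
  rw [← coe_mul_zeta_apply, moebius_mul_coe_zeta, one_apply]

/-- The number of nonzero ideals of norm at most `s`. -/
noncomputable def idealCount (R : Type*) [CommRing R] [IsDedekindDomain R] [Module.Free ℤ R]
    (s : ℝ) : ℕ :=
  {J : Ideal R | J ≠ ⊥ ∧ (Ideal.absNorm J : ℝ) ≤ s}.ncard

namespace IsQuadraticBasis

variable {R : Type*} [CommRing R] {b : Module.Basis (Fin 2) ℤ R} {t q : ℤ}

lemma exists_content (h : IsQuadraticBasis b t q) {J : Ideal R} (hJ : J ≠ ⊥) :
    ∃ c : ℕ, 0 < c ∧ ∀ m : ℕ, J ≤ Ideal.span {(m : R)} ↔ m ∣ c := by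
  let C : Ideal ℤ :=
    (J.restrictScalars ℤ).map (b.coord 0) ⊔ (J.restrictScalars ℤ).map (b.coord 1)
  obtain ⟨k, hk⟩ := (IsPrincipalIdealRing.principal C).principal
  have hC (m : ℕ) : C ≤ Ideal.span {(m : ℤ)} ↔ J ≤ Ideal.span {(m : R)} := by
    simp only [C, sup_le_iff, Submodule.map_le_iff_le_comap]
    constructor
    · rintro ⟨h0, h1⟩ z hz
      rw [Ideal.mem_span_singleton, ← Int.cast_natCast, h.intCast_dvd_iff]
      exact ⟨Ideal.mem_span_singleton.1 (h0 hz), Ideal.mem_span_singleton.1 (h1 hz)⟩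
    · intro hm
      have (z) (hz : z ∈ J) := hm hz
      simp only [Ideal.mem_span_singleton, ← Int.cast_natCast (R := R), h.intCast_dvd_iff] at this
      exact ⟨fun z hz ↦ Ideal.mem_span_singleton.2 (this z hz).1,
        fun z hz ↦ Ideal.mem_span_singleton.2 (this z hz).2⟩
  have hmk (m : ℕ) : J ≤ Ideal.span {(m : R)} ↔ m ∣ k.natAbs := by
    rw [← hC, hk, Ideal.submodule_span_eq, Ideal.span_singleton_le_span_singleton,
      Int.natCast_dvd]
  refine ⟨k.natAbs, Nat.pos_of_ne_zero fun hk0 ↦ hJ ?_, hmk⟩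
  have := (hmk 0).2 (by rw [hk0])
  simpa using this

variable [IsDedekindDomain R] [Module.Free ℤ R] [Module.Finite ℤ R]

lemma absNorm_span_natCast (_h : IsQuadraticBasis b t q) (m : ℕ) :
    Ideal.absNorm (Ideal.span {(m : R)}) = m ^ 2 := by
  rw [Ideal.absNorm_span_natCast, Module.finrank_eq_card_basis b, Fintype.card_fin]

lemma ncard_le_span (h : IsQuadraticBasis b t q) [CharZero R] {m : ℕ} (hm : 0 < m) (T : ℝ) :
    {J : Ideal R | (J ≠ ⊥ ∧ (Ideal.absNorm J : ℝ) ≤ T) ∧ J ≤ Ideal.span {(m : R)}}.ncard =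
      idealCount R (T / m ^ 2) := by
  have hmR : (m : R) ≠ 0 := by exact_mod_cast hm.ne'
  have hspan : Ideal.span {(m : R)} ≠ ⊥ := by simpa using hmR
  symm
  refine Set.ncard_congr (fun J _ ↦ Ideal.span {(m : R)} * J) ?_ ?_ ?_
  · rintro J ⟨hJ, hJT⟩
    refine ⟨⟨mul_ne_zero hspan hJ, ?_⟩, Ideal.dvd_iff_le.1 (dvd_mul_right _ _)⟩
    rw [map_mul, h.absNorm_span_natCast]
    push_cast
    rwa [le_div_iff₀' (by positivity)] at hJT
  · intro I J _ _ hIJ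
    exact mul_left_cancel₀ hspan hIJ
  · rintro J ⟨⟨hJ, hJT⟩, hJm⟩
    obtain ⟨I, rfl⟩ := Ideal.dvd_iff_le.2 hJm
    refine ⟨I, ⟨fun hI ↦ hJ (by simp [hI]), ?_⟩, rfl⟩
    rw [map_mul, h.absNorm_span_natCast] at hJT
    push_cast at hJT
    rwa [le_div_iff₀' (by positivity)]

lemma finite_absNorm_le (_h : IsQuadraticBasis b t q) [CharZero R] (T : ℝ) :
    {J : Ideal R | J ≠ ⊥ ∧ (Ideal.absNorm J : ℝ) ≤ T}.Finite := by
  exact (Ideal.finite_setOfPred_absNorm_le ⌊T⌋₊).subset fun J hJ ↦ Nat.le_floor hJ.2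

lemma idealCount_mono (h : IsQuadraticBasis b t q) [CharZero R] : Monotone (idealCount R) :=
  fun _ T hST ↦ Set.ncard_le_ncard (fun _ hJ ↦ ⟨hJ.1, hJ.2.trans hST⟩) (h.finite_absNorm_le T)

lemma idealCount_eq_zero (h : IsQuadraticBasis b t q) [CharZero R] {T : ℝ} (hT : T < 1) :
    idealCount R T = 0 := by
  rw [idealCount, Set.ncard_eq_zero (h.finite_absNorm_le T)]
  refine Set.eq_empty_of_forall_notMem fun J hJ ↦ ?_
  have h1 : Ideal.absNorm J ≠ 0 := Ideal.absNorm_eq_zero_iff.not.2 hJ.1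
  have h2 : (1 : ℝ) ≤ Ideal.absNorm J := by exact_mod_cast Nat.one_le_iff_ne_zero.2 h1
  linarith [hJ.2]

open ArithmeticFunction in
lemma sum_rootCount (h : IsQuadraticBasis b t q) [CharZero R] {T : ℝ} (hT : 0 ≤ T) :
    (∑ a ∈ Finset.Icc 1 ⌊T⌋₊, (rootCount t q a : ℝ)) =
      ∑ m ∈ Finset.Icc 1 ⌊T⌋₊, (moebius m : ℝ) * idealCount R (T / m ^ 2) := by
  classical
  let S := (h.finite_absNorm_le T).toFinset
  have hS (J : Ideal R) : J ∈ S ↔ J ≠ ⊥ ∧ (Ideal.absNorm J : ℝ) ≤ T := by simp [S]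
  have hleft : ∑ a ∈ Finset.Icc 1 ⌊T⌋₊, rootCount t q a =
      (S.filter fun J ↦ J.IsPrimitive).card := by
    rw [Finset.card_eq_sum_card_fiberwise (f := fun J ↦ Ideal.absNorm J)
      (t := Finset.Icc 1 ⌊T⌋₊)]
    · refine Finset.sum_congr rfl fun a ha ↦ ?_
      rw [Finset.mem_Icc] at ha
      rw [← h.ncard_isPrimitive_absNorm_eq ha.1, ← Set.ncard_coe_finset]
      congr 1
      ext J
      simp only [Finset.coe_filter, Finset.mem_filter, Set.mem_ofPred_eq, hS]
      constructor
      · rintro ⟨hJ, rfl⟩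
        refine ⟨⟨⟨?_, (Nat.le_floor_iff hT).1 ha.2⟩, hJ⟩, rfl⟩
        rintro rfl
        simp at ha
      · rintro ⟨⟨-, hJ⟩, hJa⟩
        exact ⟨hJ, hJa⟩
    · intro J hJ
      simp only [Finset.coe_filter, Set.mem_ofPred_eq, hS] at hJ
      simp only [Finset.coe_Icc, Set.mem_Icc]
      exact ⟨Nat.one_le_iff_ne_zero.2 (Ideal.absNorm_eq_zero_iff.not.2 hJ.1.1),
        Nat.le_floor hJ.1.2⟩
  have hprim (J) (hJ : J ∈ S) : (if J.IsPrimitive then 1 else 0 : ℤ) =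
      ∑ m ∈ Finset.Icc 1 ⌊T⌋₊, if J ≤ Ideal.span {(m : R)} then moebius m else 0 := by
    rw [hS] at hJ
    obtain ⟨c, hc, hcJ⟩ := h.exists_content hJ.1
    have hcp : J.IsPrimitive ↔ c = 1 := by
      simp only [Ideal.IsPrimitive, hcJ]
      exact ⟨fun hh ↦ hh c dvd_rfl, fun hc1 m hm ↦ Nat.dvd_one.1 (hc1 ▸ hm)⟩
    simp only [hcp]
    rw [← sum_divisors_moebius c, ← Finset.sum_filter]
    refine Finset.sum_congr ?_ fun _ _ ↦ rfl
    ext m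
    simp only [Nat.mem_divisors, Finset.mem_filter, Finset.mem_Icc, hcJ]
    refine ⟨fun ⟨hm, _⟩ ↦ ⟨⟨Nat.pos_of_dvd_of_pos hm hc, ?_⟩, hm⟩, fun hm ↦ ⟨hm.2, hc.ne'⟩⟩
    have h1 := Ideal.absNorm_dvd_absNorm_of_le ((hcJ m).2 hm)
    rw [h.absNorm_span_natCast] at h1
    have h2 := Nat.le_of_dvd (Nat.pos_of_ne_zero (Ideal.absNorm_eq_zero_iff.not.2 hJ.1)) h1
    exact (Nat.le_self_pow two_ne_zero m).trans (h2.trans (Nat.le_floor hJ.2))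
  have hcount (m) (hm : m ∈ Finset.Icc 1 ⌊T⌋₊) :
      (S.filter fun J ↦ J ≤ Ideal.span {(m : R)}).card = idealCount R (T / m ^ 2) := by
    rw [← h.ncard_le_span (Finset.mem_Icc.1 hm).1, ← Set.ncard_coe_finset]
    simp only [Finset.coe_filter, hS]
  have key : ((∑ a ∈ Finset.Icc 1 ⌊T⌋₊, rootCount t q a : ℕ) : ℤ) =
      ∑ m ∈ Finset.Icc 1 ⌊T⌋₊, moebius m * idealCount R (T / m ^ 2) := by
    rw [hleft, Finset.card_filter]
    push_cast
    rw [Finset.sum_congr rfl hprim, Finset.sum_comm]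
    refine Finset.sum_congr rfl fun m hm ↦ ?_
    rw [← hcount m hm, ← Finset.sum_filter, Finset.sum_const, nsmul_eq_mul, mul_comm]
  exact_mod_cast congrArg (Int.cast : ℤ → ℝ) key

open ArithmeticFunction in
theorem hasMean_rootCount (h : IsQuadraticBasis b t q) [CharZero R] {κ : ℝ}
    (hκ : Tendsto (fun s : ℝ ↦ (idealCount R s : ℝ) / s) atTop (nhds κ)) :
    HasMean (fun a ↦ rootCount t q a) (κ * (6 / π ^ 2)) := by
  obtain ⟨C, hC0, hC⟩ : ∃ C : ℝ, 0 ≤ C ∧ ∀ s : ℝ, 0 < s → (idealCount R s : ℝ) ≤ C * s := by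
    obtain ⟨s₀, hs₀⟩ := eventually_atTop.1 (hκ.eventually_le_const (lt_add_one κ))
    refine ⟨max |κ + 1| (idealCount R s₀), (abs_nonneg _).trans (le_max_left _ _),
      fun s hs ↦ ?_⟩
    rcases le_total s₀ s with h1 | h1
    · have := hs₀ s h1
      rw [div_le_iff₀ hs] at this
      exact this.trans (mul_le_mul_of_nonneg_right
        ((le_abs_self _).trans (le_max_left _ _)) hs.le)
    · rcases lt_or_ge s 1 with h2 | h2
      · rw [h.idealCount_eq_zero h2]
        have := (abs_nonneg (κ + 1)).trans (le_max_left _ (idealCount R s₀ : ℝ))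
        simpa using mul_nonneg this hs.le
      · have h3 : (idealCount R s : ℝ) ≤ idealCount R s₀ := by
          exact_mod_cast h.idealCount_mono h1
        have h4 := le_max_right |κ + 1| (idealCount R s₀ : ℝ)
        nlinarith [Nat.cast_nonneg (α := ℝ) (idealCount R s)]
  have hmu (m : ℕ) : |(moebius m : ℝ)| ≤ 1 := by exact_mod_cast abs_moebius_le_one (n := m)
  have hlim := tendsto_tsum_of_dominated_convergence (𝓕 := atTop)
    (f := fun (T : ℝ) (m : ℕ) ↦ (moebius m : ℝ) * idealCount R (T / m ^ 2) / T)
    (g := fun m : ℕ ↦ κ * ((moebius m : ℝ) / m ^ 2)) (bound := fun m : ℕ ↦ C * (1 / (m : ℝ) ^ 2))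
    ((summable_one_div_nat_pow.2 one_lt_two).mul_left C) (fun m ↦ ?_) ?_
  · rw [tsum_mul_left, hasSum_moebius_div_sq.tsum_eq] at hlim
    refine hlim.congr' ?_
    filter_upwards [eventually_ge_atTop 1] with T hT
    rw [h.sum_rootCount (by linarith), Finset.sum_div]
    refine tsum_eq_sum fun m hm ↦ ?_
    rcases Nat.eq_zero_or_pos m with rfl | hm0
    · simp
    · have hmT : T < m := by
        rw [Finset.mem_Icc, not_and, not_le] at hm
        exact (Nat.floor_lt (by linarith)).1 (hm hm0)
      have : T / m ^ 2 < 1 := by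
        rw [div_lt_one (by positivity)]
        nlinarith
      rw [h.idealCount_eq_zero this]
      simp
  · rcases Nat.eq_zero_or_pos m with rfl | hm0
    · simp
    · have hm2 : (0 : ℝ) < (m : ℝ) ^ 2 := by positivity
      have := (hκ.comp (tendsto_id.atTop_div_const hm2)).mul_const ((moebius m : ℝ) / m ^ 2)
      refine this.congr fun T ↦ ?_
      simp only [Function.comp_apply, id]
      field_simp
  · filter_upwards [eventually_gt_atTop 0] with T hT m
    rcases Nat.eq_zero_or_pos m with rfl | hm0
    · simp
    · rw [norm_eq_abs, abs_div, abs_mul, abs_of_pos hT, Nat.abs_cast, div_le_iff₀ hT]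
      have h1 := hC (T / m ^ 2) (by positivity)
      calc _ ≤ 1 * (idealCount R (T / m ^ 2) : ℝ) := by gcongr; exact hmu m
        _ ≤ C * (T / m ^ 2) := by rw [one_mul]; exact h1
        _ = _ := by ring

end IsQuadraticBasis

lemma exists_isQuadraticBasis {R : Type*} [CommRing R] (e : Module.Basis (Fin 2) ℤ R) :
    ∃ (b : Module.Basis (Fin 2) ℤ R) (t q : ℤ), IsQuadraticBasis b t q := by
  have : Module.Finite ℤ R := Module.Finite.of_basis e
  have : Module.Free ℤ R := Module.Free.of_basis e
  have h1 := e.sum_repr 1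
  rw [Fin.sum_univ_two] at h1
  have hcop : IsCoprime (e.repr 1 0) (e.repr 1 1) := by
    rw [Int.isCoprime_iff_gcd_eq_one]
    set g := Int.gcd (e.repr 1 0) (e.repr 1 1)
    obtain ⟨x, hx⟩ : (g : ℤ) ∣ e.repr 1 0 := Int.gcd_dvd_left ..
    obtain ⟨y, hy⟩ : (g : ℤ) ∣ e.repr 1 1 := Int.gcd_dvd_right ..
    rw [hx, hy] at h1
    have hg : algebraMap ℤ R g * (x • e 0 + y • e 1) = 1 := by
      rw [← h1]
      simp only [zsmul_eq_mul, eq_intCast]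
      push_cast
      ring
    have hu := (IsUnit.of_mul_eq_one _ hg).map (Algebra.norm ℤ)
    rw [Algebra.norm_algebraMap, Module.finrank_eq_card_basis e, Fintype.card_fin,
      isUnit_pow_iff two_ne_zero, Int.ofNat_isUnit, Nat.isUnit_iff] at hu
    exact hu
  obtain ⟨x, y, hxy⟩ := hcop
  have hdet : IsUnit (e.det ![1, (-y) • e 0 + x • e 1]) := by
    rw [Module.Basis.det_apply, Matrix.det_fin_two]
    simp only [Module.Basis.toMatrix_apply, Matrix.cons_val_zero, Matrix.cons_val_one, map_add,
      map_smul, e.repr_self, Finsupp.add_apply, Finsupp.smul_apply]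
    convert isUnit_one
    simp
    linear_combination hxy
  obtain ⟨hli, hsp⟩ := (Module.Basis.is_basis_iff_det e).2 hdet
  let b := Module.Basis.mk hli hsp.ge
  have hb0 : b 0 = 1 := by simp [b]
  refine ⟨b, b.repr (b 1 ^ 2) 1, -b.repr (b 1 ^ 2) 0, hb0, ?_⟩
  have h2 := b.sum_repr (b 1 ^ 2)
  rw [Fin.sum_univ_two, hb0] at h2
  simp only [zsmul_eq_mul] at h2
  push_cast
  linear_combination -h2

namespace IsQuadraticBasis

variable {R : Type*} [CommRing R] {b : Module.Basis (Fin 2) ℤ R} {t q : ℤ}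

lemma discr_eq (h : IsQuadraticBasis b t q) : Algebra.discr ℤ b = t ^ 2 - 4 * q := by
  have htr (z : R) : Algebra.trace ℤ R z = 2 * b.coord 0 z + t * b.coord 1 z := by
    rw [Algebra.trace_eq_matrix_trace b, Matrix.trace_fin_two, Algebra.leftMulMatrix_eq_repr_mul,
      Algebra.leftMulMatrix_eq_repr_mul, ← Module.Basis.coord_apply, ← Module.Basis.coord_apply,
      h.coord_one_mul, h.coord_zero_one, h.coord_one_one, h.zero, mul_one]
    ring
  have h10 : b.coord 0 (1 : R) = 1 := by simpa using h.coord_zero_intCast 1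
  have h11 : b.coord 1 (1 : R) = 0 := by simpa using h.coord_one_intCast 1
  simp only [Algebra.discr_def, Matrix.det_fin_two, Algebra.traceMatrix_apply,
    Algebra.traceForm_apply, htr, h.coord_zero_mul, h.coord_one_mul, h.zero, h10, h11,
    h.coord_zero_one, h.coord_one_one]
  ring

/-- The norm form `x ^ 2 + t * x * y + q * y ^ 2` is multiplicative. -/
lemma norm_form_mul (h : IsQuadraticBasis b t q) (z w : R) :
    (b.coord 0 (z * w) ^ 2 + t * b.coord 0 (z * w) * b.coord 1 (z * w) +
      q * b.coord 1 (z * w) ^ 2) =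
    (b.coord 0 z ^ 2 + t * b.coord 0 z * b.coord 1 z + q * b.coord 1 z ^ 2) *
      (b.coord 0 w ^ 2 + t * b.coord 0 w * b.coord 1 w + q * b.coord 1 w ^ 2) := by
  rw [h.coord_zero_mul, h.coord_one_mul]
  ring

lemma card_units (h : IsQuadraticBasis b t q) (hneg : t ^ 2 - 4 * q < 0) :
    Nat.card Rˣ = {v : ℤ × ℤ | v.1 ^ 2 + t * v.1 * v.2 + q * v.2 ^ 2 = 1}.ncard := by
  have h10 : b.coord 0 (1 : R) = 1 := by simpa using h.coord_zero_intCast 1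
  have h11 : b.coord 1 (1 : R) = 0 := by simpa using h.coord_one_intCast 1
  rw [← Nat.card_coe_set_eq]
  refine Nat.card_congr (Equiv.ofBijective
    (fun u ↦ ⟨(b.coord 0 (u : R), b.coord 1 (u : R)), ?_⟩) ⟨?_, ?_⟩)
  · have hu := h.norm_form_mul (u : R) (↑u⁻¹ : R)
    rw [u.mul_inv, h10, h11] at hu
    have hpos (x y : ℤ) : 0 ≤ x ^ 2 + t * x * y + q * y ^ 2 := by
      nlinarith [sq_nonneg (2 * x + t * y), mul_nonneg (neg_pos.2 hneg).le (sq_nonneg y)]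
    refine Int.eq_one_of_mul_eq_one_right (hpos _ _) (hu.symm.trans ?_)
    ring
  · intro u v huv
    simp only [Subtype.mk.injEq, Prod.mk.injEq] at huv
    ext
    rw [h.eq_coord (u : R), h.eq_coord (v : R), huv.1, huv.2]
  · rintro ⟨⟨x, y⟩, hxy⟩
    have hmul : ((x : R) + y * b 1) * (((x + t * y : ℤ) : R) + ((-y : ℤ) : R) * b 1) = 1 := by
      have := congrArg (Int.cast : ℤ → R) hxy
      push_cast at this ⊢
      linear_combination this - (y : R) ^ 2 * h.one_sq
    refine ⟨Units.mkOfMulEqOne _ _ hmul, ?_⟩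
    simp only [Units.val_mkOfMulEqOne, h.coord_zero, h.coord_one]

end IsQuadraticBasis

lemma ncard_norm_form_eq_one {d t q : ℤ} (hd : IsFundamentalDiscriminant d) (hneg : d < 0)
    (hD : t ^ 2 - 4 * q = d) :
    {v : ℤ × ℤ | v.1 ^ 2 + t * v.1 * v.2 + q * v.2 ^ 2 = 1}.ncard = omegaDisc d := by
  obtain ⟨k, hk⟩ : ∃ k, t = 2 * k ∨ t = 2 * k + 1 := ⟨t / 2, by omega⟩
  have hinj : Function.Injective fun v : ℤ × ℤ ↦ (v.1 - k * v.2, v.2) := by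
    rintro ⟨x, y⟩ ⟨x', y'⟩ hv
    simp only [Prod.mk.injEq] at hv
    obtain ⟨h1, rfl⟩ := hv
    simpa using h1
  have key (S : Finset (ℤ × ℤ))
      (hS : ∀ x y : ℤ, (x - k * y) ^ 2 + t * (x - k * y) * y + q * y ^ 2 = 1 ↔ (x, y) ∈ S) :
      {v : ℤ × ℤ | v.1 ^ 2 + t * v.1 * v.2 + q * v.2 ^ 2 = 1}.ncard = S.card := by
    rw [← Set.ncard_coe_finset, ← Set.ncard_image_of_injective (S : Set (ℤ × ℤ)) hinj]
    congr 1
    ext ⟨x, y⟩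
    simp only [Set.mem_ofPred_eq, Set.mem_image, Finset.mem_coe, Prod.exists, Prod.mk.injEq]
    constructor
    · intro hxy
      refine ⟨x + k * y, y, (hS _ _).1 ?_, by ring, rfl⟩
      rw [← hxy]
      ring
    · rintro ⟨x', y', hm, rfl, rfl⟩
      exact (hS _ _).2 hm
  have hmod : d % 4 = 1 ∨ d % 4 = 0 := by
    rcases hd with ⟨h, -⟩ | ⟨m, h, -⟩ <;> omega
  rcases hmod with hmod | hmod
  · have ht : t = 2 * k + 1 := by
      rcases hk with rfl | hk
      · have : d = 4 * (k ^ 2 - q) := by rw [← hD]; ring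
        omega
      · exact hk
    subst ht
    rcases eq_or_ne d (-3) with rfl | hd3
    · have hq : q = k ^ 2 + k + 1 := by linarith
      rw [key {(1, 0), (-1, 0), (0, 1), (-1, 1), (0, -1), (1, -1)}]
      · rfl
      · intro x y
        have : (x - k * y) ^ 2 + (2 * k + 1) * (x - k * y) * y + q * y ^ 2 =
            x ^ 2 + x * y + y ^ 2 := by rw [hq]; ring
        rw [this]
        simp only [Finset.mem_insert, Finset.mem_singleton, Prod.mk.injEq]
        constructor
        · intro h
          have hy1 : y ≤ 1 := by nlinarith [sq_nonneg (2 * x + y)]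
          have hy2 : -1 ≤ y := by nlinarith [sq_nonneg (2 * x + y)]
          have hx1 : x ≤ 1 := by nlinarith [sq_nonneg (2 * y + x)]
          have hx2 : -1 ≤ x := by nlinarith [sq_nonneg (2 * y + x)]
          interval_cases x <;> interval_cases y <;> simp_all
        · rintro (⟨rfl, rfl⟩ | ⟨rfl, rfl⟩ | ⟨rfl, rfl⟩ | ⟨rfl, rfl⟩ | ⟨rfl, rfl⟩ | ⟨rfl, rfl⟩) <;>
            norm_num
    · have hd7 : d ≤ -7 := by omega
      rw [key {(1, 0), (-1, 0)}]
      · rw [omegaDisc, if_neg (by omega), if_neg hd3]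
        rfl
      · intro x y
        have : 4 * ((x - k * y) ^ 2 + (2 * k + 1) * (x - k * y) * y + q * y ^ 2) =
            (2 * x + y) ^ 2 - d * y ^ 2 := by rw [← hD]; ring
        simp only [Finset.mem_insert, Finset.mem_singleton, Prod.mk.injEq]
        constructor
        · intro h
          rw [h] at this
          have hy1 : y < 1 := by nlinarith [sq_nonneg (2 * x + y)]
          have hy2 : -1 < y := by nlinarith [sq_nonneg (2 * x + y)]
          obtain rfl : y = 0 := by omega
          have : (x - 1) * (x + 1) = 0 := by linarith
          rcases mul_eq_zero.1 this with h | h <;> omega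
        · rintro (⟨rfl, rfl⟩ | ⟨rfl, rfl⟩) <;> norm_num
  · have ht : t = 2 * k := by
      rcases hk with hk | rfl
      · exact hk
      · have : d = 4 * (k ^ 2 + k - q) + 1 := by rw [← hD]; ring
        omega
    subst ht
    rcases eq_or_ne d (-4) with rfl | hd4
    · have hq : q = k ^ 2 + 1 := by linarith
      rw [key {(1, 0), (-1, 0), (0, 1), (0, -1)}]
      · rfl
      · intro x y
        have : (x - k * y) ^ 2 + (2 * k) * (x - k * y) * y + q * y ^ 2 =
            x ^ 2 + y ^ 2 := by rw [hq]; ring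
        rw [this]
        simp only [Finset.mem_insert, Finset.mem_singleton, Prod.mk.injEq]
        constructor
        · intro h
          have hy1 : y ≤ 1 := by nlinarith
          have hy2 : -1 ≤ y := by nlinarith
          have hx1 : x ≤ 1 := by nlinarith
          have hx2 : -1 ≤ x := by nlinarith
          interval_cases x <;> interval_cases y <;> simp_all
        · rintro (⟨rfl, rfl⟩ | ⟨rfl, rfl⟩ | ⟨rfl, rfl⟩ | ⟨rfl, rfl⟩) <;> norm_num
    · have hd8 : d ≤ -8 := by omega
      rw [key {(1, 0), (-1, 0)}]
      · rw [omegaDisc, if_neg hd4, if_neg (by omega)]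
        rfl
      · intro x y
        have : 4 * ((x - k * y) ^ 2 + (2 * k) * (x - k * y) * y + q * y ^ 2) =
            (2 * x) ^ 2 - d * y ^ 2 := by rw [← hD]; ring
        simp only [Finset.mem_insert, Finset.mem_singleton, Prod.mk.injEq]
        constructor
        · intro h
          rw [h] at this
          have hy1 : y < 1 := by nlinarith [sq_nonneg (2 * x)]
          have hy2 : -1 < y := by nlinarith [sq_nonneg (2 * x)]
          obtain rfl : y = 0 := by omega
          have : (x - 1) * (x + 1) = 0 := by linarith
          rcases mul_eq_zero.1 this with h | h <;> omega
        · rintro (⟨rfl, rfl⟩ | ⟨rfl, rfl⟩) <;> norm_num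

namespace NumberField

open InfinitePlace NumberField.Units

variable {K : Type*} [Field K] [NumberField K]

lemma nrPlaces_of_discr_neg (hdeg : Module.finrank ℚ K = 2) (hneg : discr K < 0) :
    nrRealPlaces K = 0 ∧ nrComplexPlaces K = 1 := by
  have h1 := card_add_two_mul_card_eq_rank K
  have h2 := sign_discr K
  rw [Int.sign_eq_neg_one_of_neg hneg] at h2
  rw [hdeg] at h1
  have h3 : nrComplexPlaces K ≠ 0 := by
    intro h
    simp [h] at h2
  omega

lemma rank_eq_zero_of_discr_neg (hdeg : Module.finrank ℚ K = 2) (hneg : discr K < 0) :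
    rank K = 0 := by
  obtain ⟨h1, h2⟩ := nrPlaces_of_discr_neg hdeg hneg
  rw [rank, card_eq_nrRealPlaces_add_nrComplexPlaces, h1, h2]

open scoped Classical in
lemma regulator_eq_one_of_discr_neg (hdeg : Module.finrank ℚ K = 2) (hneg : discr K < 0) :
    regulator K = 1 := by
  have : IsEmpty (Fin (rank K)) := by
    rw [rank_eq_zero_of_discr_neg hdeg hneg]
    infer_instance
  have : IsEmpty {w : InfinitePlace K // w ≠ dirichletUnitTheorem.w₀} :=
    (equivFinRank K).symm.isEmpty
  rw [regulator_eq_det', Matrix.det_eq_one_of_card_eq_zero (Fintype.card_eq_zero_iff.2 this),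
    abs_one]

lemma torsionOrder_eq_of_discr_neg (hdeg : Module.finrank ℚ K = 2) (hneg : discr K < 0) :
    torsionOrder K = Nat.card (𝓞 K)ˣ := by
  have : IsEmpty (Fin (rank K)) := by
    rw [rank_eq_zero_of_discr_neg hdeg hneg]
    infer_instance
  have h := closure_fundSystem_sup_torsion_eq_top K
  rw [Set.range_eq_empty, Subgroup.closure_empty, bot_sup_eq] at h
  rw [torsionOrder, h, Subgroup.card_top]

theorem hasMean_rootCount {d : ℤ} (hfund : IsFundamentalDiscriminant d) (hneg : d < 0)
    (hdeg : Module.finrank ℚ K = 2) (hdiscr : discr K = d) :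
    ∃ t q : ℤ, t ^ 2 - 4 * q = d ∧ HasMean (fun a ↦ rootCount t q a)
      (2 * π * classNumber K / (omegaDisc d * √|(d : ℝ)|) * (6 / π ^ 2)) := by
  have hrank : Module.finrank ℤ (𝓞 K) = 2 := by rw [RingOfIntegers.rank, hdeg]
  obtain ⟨b, t, q, h⟩ := exists_isQuadraticBasis (Module.finBasisOfFinrankEq ℤ (𝓞 K) hrank)
  have hD : t ^ 2 - 4 * q = d := by rw [← h.discr_eq, discr_eq_discr, hdiscr]
  refine ⟨t, q, hD, h.hasMean_rootCount ?_⟩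
  have hnegK : discr K < 0 := hdiscr ▸ hneg
  have hlim := Ideal.tendsto_norm_le_div_atTop₀ K
  obtain ⟨h1, h2⟩ := nrPlaces_of_discr_neg hdeg hnegK
  rw [h1, h2, regulator_eq_one_of_discr_neg hdeg hnegK, torsionOrder_eq_of_discr_neg hdeg hnegK,
    h.card_units (hD ▸ hneg), ncard_norm_form_eq_one hfund hneg hD, hdiscr, pow_zero, pow_one,
    one_mul, mul_one] at hlim
  convert! hlim using 4 with s
  · rw [idealCount, ← Nat.card_coe_set_eq]
    refine Nat.card_congr ((Equiv.subtypeEquivRight fun J ↦ ?_).trans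
      (Equiv.subtypeSubtypeEquivSubtypeInter (· ∈ nonZeroDivisors (Ideal (𝓞 K)))
        fun J ↦ (Ideal.absNorm J : ℝ) ≤ s).symm)
    rw [mem_nonZeroDivisors_iff_ne_zero]
    rfl

end NumberField

lemma HasMean.congr_of_lt {F G : ℕ → ℝ} {c : ℝ} (hF : HasMean F c) (N : ℕ)
    (h : ∀ a, N < a → F a = G a) : HasMean G c := by
  have hconst : Tendsto (fun T : ℝ ↦ (∑ a ∈ Finset.Icc 1 N, (G a - F a)) / T) atTop (nhds 0) :=
    tendsto_const_nhds.div_atTop tendsto_id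
  have hadd := Tendsto.add hF hconst
  rw [add_zero] at hadd
  refine hadd.congr' ?_
  filter_upwards [eventually_ge_atTop (N : ℝ)] with T hT
  have hN : N ≤ ⌊T⌋₊ := Nat.le_floor hT
  have hsum : ∑ a ∈ Finset.Icc 1 N, (G a - F a) = ∑ a ∈ Finset.Icc 1 ⌊T⌋₊, (G a - F a) := by
    refine Finset.sum_subset (Finset.Icc_subset_Icc_right hN) fun a ha haN ↦ ?_
    simp only [Finset.mem_Icc] at ha haN
    rw [h a (by omega), sub_self]
  rw [hsum, ← add_div, ← Finset.sum_add_distrib]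
  simp

open scoped Classical in
/-- The number of integers `0 < c < a` such that `a * c + n` is a perfect square. -/
noncomputable def partnerCount (n : ℤ) (a : ℕ) : ℕ :=
  ((Finset.Ioo (0 : ℤ) a).filter fun c ↦ ∃ b : ℤ, b ^ 2 = a * c + n).card

lemma rootCount_eq_partnerCount {n : ℤ} (hn : n < 0) {a : ℕ} (ha : n.natAbs < a) :
    rootCount 0 (-n) a = partnerCount n a := by
  classical
  have han : -n < a := by omega
  have ha0 : (0 : ℤ) < a := by omega
  refine Finset.card_bij (fun x _ ↦ ((x : ℤ) ^ 2 - n) / a) ?_ ?_ ?_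
  · intro x hx
    simp only [Finset.mem_filter, Finset.mem_range] at hx
    obtain ⟨hxa, c, hc⟩ := hx
    have hc : (x : ℤ) ^ 2 - n = a * c := by linarith
    have hxa : (x : ℤ) + 1 ≤ a := by exact_mod_cast hxa
    have hx0 : (0 : ℤ) ≤ x := by positivity
    simp only [hc, Int.mul_ediv_cancel_left _ ha0.ne', Finset.mem_filter, Finset.mem_Ioo]
    refine ⟨⟨?_, ?_⟩, x, by linarith⟩
    · by_contra! h0
      nlinarith
    · by_contra! h0
      nlinarith
  · intro x hx y hy hxy
    simp only [Finset.mem_filter, Finset.mem_range] at hx hy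
    obtain ⟨-, c, hc⟩ := hx
    obtain ⟨-, d, hd⟩ := hy
    have hc : (x : ℤ) ^ 2 - n = a * c := by linarith
    have hd : (y : ℤ) ^ 2 - n = a * d := by linarith
    simp only [hc, hd, Int.mul_ediv_cancel_left _ ha0.ne'] at hxy
    subst hxy
    have : (x : ℤ) ^ 2 = (y : ℤ) ^ 2 := by linarith
    have : x ^ 2 = y ^ 2 := by exact_mod_cast this
    exact Nat.pow_left_injective two_ne_zero this
  · intro c hc
    simp only [Finset.mem_filter, Finset.mem_Ioo] at hc
    obtain ⟨⟨hc0, hca⟩, b, hb⟩ := hc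
    refine ⟨b.natAbs, ?_, ?_⟩
    · simp only [Finset.mem_filter, Finset.mem_range, Int.natCast_natAbs, sq_abs]
      refine ⟨?_, c, by linarith⟩
      have : |b| < a := by
        rw [← abs_of_pos ha0]
        refine sq_lt_sq.1 ?_
        nlinarith
      rw [← Int.natCast_natAbs] at this
      exact_mod_cast this
    · simp only [Int.natCast_natAbs, sq_abs, hb]
      rw [add_sub_cancel_right, Int.mul_ediv_cancel_left _ ha0.ne']

lemma DTn_eq_two_mul_sum {n : ℤ} (hn : n < 0) {T : ℝ} (hT : 0 ≤ T) :
    DTn n T = 2 * ∑ a ∈ Finset.Icc 1 ⌊T⌋₊, partnerCount n a := by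
  classical
  let S := (Finset.Icc 1 ⌊T⌋₊).sigma fun a : ℕ ↦
    (Finset.Ioo (0 : ℤ) a).filter fun c ↦ ∃ b : ℤ, b ^ 2 = a * c + n
  let P : Set (ℤ × ℤ) := {ac | 0 < ac.2 ∧ ac.2 < ac.1 ∧ (ac.1 : ℝ) ≤ T ∧
    ∃ b : ℤ, b ^ 2 = ac.1 * ac.2 + n}
  have hcast : Function.Injective fun v : (_ : ℕ) × ℤ ↦ ((v.1 : ℤ), v.2) := by
    rintro ⟨a, c⟩ ⟨a', c'⟩ h
    simp only [Prod.mk.injEq, Nat.cast_inj] at h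
    obtain ⟨rfl, rfl⟩ := h
    rfl
  have hP : P = (fun v : (_ : ℕ) × ℤ ↦ ((v.1 : ℤ), v.2)) '' S := by
    ext ⟨a, c⟩
    simp only [P, S, Set.mem_ofPred_eq, Set.mem_image, Finset.mem_coe, Finset.mem_sigma,
      Finset.mem_filter, Finset.mem_Ioo, Finset.mem_Icc, Prod.mk.injEq, Sigma.exists]
    constructor
    · rintro ⟨hc, hca, haT, hb⟩
      lift a to ℕ using by omega
      exact ⟨a, c, ⟨⟨by omega, Nat.le_floor (by exact_mod_cast haT)⟩, ⟨hc, hca⟩, hb⟩, rfl, rfl⟩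
    · rintro ⟨a, c, ⟨⟨-, haT⟩, ⟨hc, hca⟩, hb⟩, rfl, rfl⟩
      exact ⟨hc, hca, by exact_mod_cast (Nat.le_floor_iff hT).1 haT, hb⟩
  have hPcard : P.ncard = ∑ a ∈ Finset.Icc 1 ⌊T⌋₊, partnerCount n a := by
    rw [hP, Set.ncard_image_of_injective _ hcast, Set.ncard_coe_finset, Finset.card_sigma]
    rfl
  have hPfin : P.Finite := hP ▸ S.finite_toSet.image _
  let neg : ℤ × ℤ → ℤ × ℤ := fun v ↦ (-v.2, -v.1)
  have hneg : Function.Injective neg := by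
    rintro ⟨a, c⟩ ⟨a', c'⟩ h
    simpa [neg, and_comm] using h
  have hunion : {ac : ℤ × ℤ | ac.2 < ac.1 ∧ ac.1 ≠ 0 ∧ ac.2 ≠ 0 ∧
      |(ac.1 : ℝ)| ≤ T ∧ |(ac.2 : ℝ)| ≤ T ∧ ∃ b : ℤ, b ^ 2 = ac.1 * ac.2 + n} =
      P ∪ neg '' P := by
    ext ⟨a, c⟩
    simp only [P, neg, Set.mem_ofPred_eq, Set.mem_union, Set.mem_image, Prod.exists,
      Prod.mk.injEq]
    constructor
    · rintro ⟨hca, ha, hc, haT, hcT, b, hb⟩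
      have hpos : 0 < a * c := by nlinarith [sq_nonneg b]
      rcases lt_or_gt_of_ne hc with hc | hc
      · right
        have ha : a < 0 := by
          by_contra! h
          nlinarith
        refine ⟨-c, -a, ⟨by omega, by omega, ?_, b, by linarith⟩, by ring, by ring⟩
        push_cast
        exact (neg_le_abs _).trans hcT
      · exact Or.inl ⟨hc, hca, (le_abs_self _).trans haT, b, hb⟩
    · have habs {x y : ℤ} (hy : 0 < y) (hyx : y < x) (hx : (x : ℝ) ≤ T) :
          |(x : ℝ)| ≤ T ∧ |(y : ℝ)| ≤ T := by
        have hy' : (0 : ℝ) < y := by exact_mod_cast hy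
        have hyx' : (y : ℝ) < x := by exact_mod_cast hyx
        rw [abs_of_pos hy', abs_of_pos (hy'.trans hyx')]
        exact ⟨hx, hyx'.le.trans hx⟩
      rintro (⟨hc, hca, haT, hb⟩ | ⟨x, y, ⟨hy, hyx, hxT, b, hb⟩, rfl, rfl⟩)
      · exact ⟨hca, by omega, by omega, (habs hc hca haT).1, (habs hc hca haT).2, hb⟩
      · refine ⟨by omega, by omega, by omega, ?_, ?_, b, by linarith⟩
        · push_cast
          rw [abs_neg]
          exact (habs hy hyx hxT).2
        · push_cast
          rw [abs_neg]
          exact (habs hy hyx hxT).1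
  have hdisj : Disjoint P (neg '' P) := by
    rw [Set.disjoint_left]
    rintro _ ⟨h1, -⟩ ⟨⟨x, y⟩, ⟨h3, h4, -⟩, rfl⟩
    simp only [neg] at h1 h3 h4
    omega
  rw [DTn, hunion, Set.ncard_union_eq hdisj hPfin (hPfin.image _),
    Set.ncard_image_of_injective _ hneg, hPcard, two_mul]

lemma rootCount_mul_eq {n d t q : ℤ} {f : ℕ} (hfactor : 4 * n = (f : ℤ) ^ 2 * d)
    (hD : t ^ 2 - 4 * q = d) {a : ℕ} (ha : 0 < a) :
    rootCount (f * t) (f ^ 2 * q) a = rootCount 0 (-n) a := by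
  have : NeZero a := ⟨ha.ne'⟩
  have h4 : (f * t : ℤ) ^ 2 = 4 * (n + f ^ 2 * q) := by
    rw [mul_add, hfactor, ← hD]
    ring
  obtain ⟨s, hs⟩ : (2 : ℤ) ∣ f * t :=
    Int.prime_two.dvd_of_dvd_pow (n := 2) (h4 ▸ ⟨2 * (n + f ^ 2 * q), by ring⟩)
  rw [hs, ← rootCount_shift (2 * s) (f ^ 2 * q) (-s) a]
  rw [hs] at h4
  congr 1 <;> linarith

/-- **Theorem 3 (a).** Let `n < 0` and write `4n = f² d₀` with `d₀ < 0` a fundamental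
discriminant (`d₀` is the discriminant of the imaginary quadratic field `K = ℚ(√d₀)`,
whose class number is `h(d₀) = classNumber K`). Then, as `T → ∞`,
`D_T^n = (12T / (ω(d₀) π |n|^{1/2})) h(d₀) ∏_{p^e ∥ f} (σ₁(p^e) - χ_{d₀}(p) σ₁(p^{e-1})) + o(T)`. -/
theorem total_count_negative (n : ℤ) (hn : n < 0) (d₀ : ℤ) (f : ℕ) (hf : 0 < f)
    (hfactor : 4 * n = (f : ℤ) ^ 2 * d₀)
    (hfund : IsFundamentalDiscriminant d₀) (hd₀ : d₀ < 0)
    (K : Type) [Field K] [NumberField K]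
    (hdeg : Module.finrank ℚ K = 2) (hdiscr : NumberField.discr K = d₀) :
    (fun T : ℝ => (DTn n T : ℝ) -
        12 * T / ((omegaDisc d₀ : ℝ) * Real.pi * Real.sqrt |(n : ℝ)|) *
          (NumberField.classNumber K : ℝ) *
          ∏ p ∈ f.primeFactors,
            ((sigmaOne (p ^ (f.factorization p)) : ℝ) -
              (kroneckerChi d₀ p : ℝ) * (sigmaOne (p ^ (f.factorization p - 1)) : ℝ)))
      =o[atTop] (fun T : ℝ => T) := by
  obtain ⟨t, q, hD, hmean⟩ := NumberField.hasMean_rootCount hfund hd₀ hdeg hdiscr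
  have hmean := ((hasMean_rootCount_scale hfund hD hmean hf).congr
    (G := fun a ↦ (rootCount 0 (-n) a : ℝ))
    fun a ha ↦ by rw [rootCount_mul_eq hfactor hD ha]).congr_of_lt
    (G := fun a ↦ (partnerCount n a : ℝ)) n.natAbs
    fun a ha ↦ by rw [rootCount_eq_partnerCount hn ha]
  set L : ℝ := ∏ p ∈ f.primeFactors, ((sigmaOne (p ^ (f.factorization p)) : ℝ) -
    (kroneckerChi d₀ p : ℝ) * (sigmaOne (p ^ (f.factorization p - 1)) : ℝ))
  have hfR : (0 : ℝ) < f := by exact_mod_cast hf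
  have hsqrt : √|(d₀ : ℝ)| = 2 * √|(n : ℝ)| / f := by
    have h : 4 * (n : ℝ) = (f : ℝ) ^ 2 * d₀ := by exact_mod_cast hfactor
    have hd : |(d₀ : ℝ)| = (2 / f) ^ 2 * |(n : ℝ)| := by
      rw [show (d₀ : ℝ) = (2 / f) ^ 2 * n by field_simp; linarith, abs_mul,
        abs_of_nonneg (sq_nonneg (2 / (f : ℝ)))]
    rw [hd, sqrt_mul (sq_nonneg _), sqrt_sq (by positivity)]
    ring
  have hnpos : 0 < √|(n : ℝ)| := by
    rw [sqrt_pos, abs_pos]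
    exact_mod_cast hn.ne
  have homega : (omegaDisc d₀ : ℝ) ≠ 0 := by
    unfold omegaDisc
    split_ifs <;> norm_num
  have hlim := ((Tendsto.const_mul 2 hmean).sub_const
    (12 / ((omegaDisc d₀ : ℝ) * π * √|(n : ℝ)|) * NumberField.classNumber K * L))
  refine (isLittleO_iff_tendsto' ?_).2 ((hlim.congr' ?_).trans_eq ?_)
  · filter_upwards [eventually_gt_atTop 0] with T hT h
    exact absurd h hT.ne'
  · filter_upwards [eventually_gt_atTop 0] with T hT
    rw [DTn_eq_two_mul_sum hn hT.le]
    push_cast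
    field_simp
  · congr 1
    rw [hsqrt]
    have := pi_pos
    field_simp
    ring
end
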